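/- arXiv:1702.03747 — 11 statements merged into one kernel-verified Lean document; each statement's English description precedes it below -/
import Mathlib

section
/- Let n ≥ 1 and let X₁,…,Xₙ and Y₁,…,Y_{n−1} be real numbers with Y_i ≠ Y_j whenever i ≠ j. Then for every k ∈ {1,…,n}: Σ_{j=1}^{n−1} [ ∏_{i=1, i≠k}^{n} (X_i − Y_j) ] / [ ∏_{i=1, i≠j}^{n−1} (Y_i − Y_j) ] = Σ_{j=1, j≠k}^{n} X_j − Σ_{j=1}^{n−1} Y_j. -/
open Polynomial in
/-- The partial-fraction identity for two finite families of the same size, with the nodes `Y`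
pairwise distinct. -/
theorem sum_prod_sub_div_prod_erase_sub {F ι κ : Type*} [Field F] [DecidableEq κ]
    (t : Finset ι) (s : Finset κ) (hts : t.card = s.card) (X : ι → F) (Y : κ → F)
    (hY : Set.InjOn Y s) :
    ∑ j ∈ s, (∏ i ∈ t, (X i - Y j)) / (∏ i ∈ s.erase j, (Y i - Y j))
      = ∑ i ∈ t, X i - ∑ j ∈ s, Y j := by
  rcases s.eq_empty_or_nonempty with rfl | hs
  · obtain rfl : t = ∅ := by simpa using hts
    simp
  have hpos : 0 < s.card := hs.card_pos
  set P : F[X] := Lagrange.nodal t X - Lagrange.nodal s Y with hP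
  have hdeg : P.degree < s.card := by
    have h := degree_sub_lt_left (p := Lagrange.nodal t X) (q := Lagrange.nodal s Y)
      (by simp [Lagrange.degree_nodal, hts]) Lagrange.nodal_ne_zero
      (by rw [Lagrange.nodal_monic.leadingCoeff, Lagrange.nodal_monic.leadingCoeff])
    rwa [Lagrange.degree_nodal, hts] at h
  have hcoeff : P.coeff (s.card - 1) = ∑ j ∈ s, Y j - ∑ i ∈ t, X i := by
    have hX := prod_X_sub_C_coeff_card_pred t X (hts ▸ hpos)
    rw [hts] at hX
    rw [hP, coeff_sub, Lagrange.nodal_eq, Lagrange.nodal_eq, hX,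
      prod_X_sub_C_coeff_card_pred s Y hpos]
    ring
  have hsum := Lagrange.coeff_eq_sum hY hdeg
  rw [← neg_sub, ← hcoeff, hsum, ← Finset.sum_neg_distrib]
  refine Finset.sum_congr rfl fun j hj => ?_
  have hnum : ∏ i ∈ t, (X i - Y j) = (-1) ^ s.card * P.eval (Y j) := by
    rw [hP, eval_sub, Lagrange.eval_nodal_at_node hj, sub_zero, Lagrange.eval_nodal, ← hts,
      ← Finset.prod_neg]
    simp
  have hden : ∏ i ∈ s.erase j, (Y i - Y j)
      = (-1) ^ (s.card - 1) * ∏ i ∈ s.erase j, (Y j - Y i) := by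
    rw [← Finset.card_erase_of_mem hj, ← Finset.prod_neg]
    simp
  have hpow : (-1 : F) ^ s.card = (-1) ^ (s.card - 1) * -1 := by
    rw [← pow_succ, Nat.sub_add_cancel hpos]
  rw [hnum, hden, hpow, mul_assoc, mul_div_mul_left _ _ (pow_ne_zero _ (by simp))]
  ring

theorem stmt0 (n : ℕ) (hn : 1 ≤ n) (X Y : ℕ → ℝ)
    (hY : ∀ i ∈ Finset.Icc 1 (n - 1), ∀ j ∈ Finset.Icc 1 (n - 1), i ≠ j → Y i ≠ Y j)
    (k : ℕ) (hk : k ∈ Finset.Icc 1 n) :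
    ∑ j ∈ Finset.Icc 1 (n - 1),
        (∏ i ∈ (Finset.Icc 1 n).erase k, (X i - Y j)) /
          (∏ i ∈ (Finset.Icc 1 (n - 1)).erase j, (Y i - Y j))
      = ∑ j ∈ (Finset.Icc 1 n).erase k, X j - ∑ j ∈ Finset.Icc 1 (n - 1), Y j := by
  refine sum_prod_sub_div_prod_erase_sub _ _ ?_ X Y ?_
  · simp [Finset.card_erase_of_mem hk]
  · intro i hi j hj hij
    by_contra hne
    exact hY i hi j hj hne hij
end

section
/- Let n ≥ 1, let μ = (μ₁,…,μ_{n−1}) ∈ ℝ^{n−1}, let z₁,…,z_{n−1} ∈ ℂ and x ∈ ℝ. Let B be the n×n skew-Hermitian matrix with entries B_{j,n} = −z_j and B_{n,j} = conj(z_j) for 1 ≤ j ≤ n−1, B_{n,n} = ix, and all other entries 0. Then for every y ∈ ℝ: det(J_μ + B − iy·I) = (−i)^n · [ (y − x)·∏_{i=1}^{n−1}(y − μ_i) − Σ_{j=1}^{n−1} |z_j|² · ∏_{i=1, i≠j}^{n−1} (y − μ_i) ]. -/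
open Polynomial in
/-- The determinant of a diagonal matrix bordered by one row and one column. -/
theorem det_fromBlocks_diagonal_border {R m : Type*} [CommRing R] [Fintype m] [DecidableEq m]
    (d : m → R) (b : Matrix m (Fin 1) R) (c : Matrix (Fin 1) m R) (e : R) :
    (Matrix.fromBlocks (Matrix.diagonal d) b c (Matrix.of fun _ _ => e)).det
      = e * ∏ i, d i - ∑ j, c 0 j * b j 0 * ∏ i ∈ Finset.univ.erase j, d i := by
  have of_regular : ∀ (S : Type _) [CommRing S] (d : m → S) (b : Matrix m (Fin 1) S)
      (c : Matrix (Fin 1) m S) (e : S), IsRegular (∏ i, d i) →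
      (Matrix.fromBlocks (Matrix.diagonal d) b c (Matrix.of fun _ _ => e)).det
        = e * ∏ i, d i - ∑ j, c 0 j * b j 0 * ∏ i ∈ Finset.univ.erase j, d i := by
    intro S _ d b c e hP
    apply hP.right
    have key : Matrix.fromBlocks (Matrix.diagonal d) b c (Matrix.of fun _ _ => e)
        * Matrix.fromBlocks 1 (Matrix.of fun j _ => -((∏ i ∈ Finset.univ.erase j, d i) * b j 0))
            0 (Matrix.of fun _ _ => ∏ i, d i)
        = Matrix.fromBlocks (Matrix.diagonal d) 0 c (Matrix.of fun _ _ =>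
            e * ∏ i, d i - ∑ j, c 0 j * b j 0 * ∏ i ∈ Finset.univ.erase j, d i) := by
      rw [Matrix.fromBlocks_multiply]
      congr 1
      · simp
      · ext i k
        obtain rfl := Subsingleton.elim k 0
        rw [Matrix.add_apply, Matrix.diagonal_mul]
        simp only [Matrix.mul_apply, Matrix.of_apply, Finset.univ_unique, Finset.sum_singleton,
          Matrix.zero_apply, ← Finset.mul_prod_erase Finset.univ d (Finset.mem_univ i),
          Fin.default_eq_zero]
        ring
      · simp
      · ext i k
        obtain rfl := Subsingleton.elim i 0
        simp only [Matrix.add_apply, Matrix.mul_apply, Matrix.of_apply,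
          Finset.univ_unique, Finset.sum_singleton, mul_neg, Finset.sum_neg_distrib]
        rw [neg_add_eq_sub]
        congr 1
        exact Finset.sum_congr rfl fun j _ => by ring
    have hdet := congrArg Matrix.det key
    rw [Matrix.det_mul, Matrix.det_fromBlocks_zero₂₁, Matrix.det_fromBlocks_zero₁₂] at hdet
    simp only [Matrix.det_one, one_mul, Matrix.det_diagonal, Matrix.det_fin_one,
      Matrix.of_apply] at hdet
    simpa only [mul_comm (∏ i, d i) (_ - _)] using hdet
  have hX := of_regular R[X] (fun i => X + C (d i)) (b.map C) (c.map C) (C e)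
    (Polynomial.monic_prod_of_monic _ _ fun i _ => Polynomial.monic_X_add_C (d i)).isRegular
  have h0 := congrArg (Polynomial.evalRingHom (0 : R)) hX
  rw [RingHom.map_det, RingHom.mapMatrix_apply, Matrix.fromBlocks_map] at h0
  convert h0 using 1
  · congr 2
    · rw [Matrix.diagonal_map (by simp)]
      congr 1
      ext i
      simp
    · ext i j
      simp
    · ext i j
      simp
    · ext i j
      simp
  · simp [Polynomial.eval_prod, Polynomial.eval_finsetSum]

theorem stmt1 (n : ℕ) (hn : 1 ≤ n) (μ : ℕ → ℝ) (z : ℕ → ℂ) (x : ℝ) (y : ℝ) :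
    (Matrix.diagonal (fun i : Fin n => if (i : ℕ) < n - 1 then Complex.I * (μ (i : ℕ) : ℂ) else 0)
        + Matrix.of (fun i j : Fin n =>
            if (i : ℕ) < n - 1 ∧ (j : ℕ) = n - 1 then -z (i : ℕ)
            else if (i : ℕ) = n - 1 ∧ (j : ℕ) < n - 1 then (starRingEnd ℂ) (z (j : ℕ))
            else if (i : ℕ) = n - 1 ∧ (j : ℕ) = n - 1 then Complex.I * (x : ℂ)
            else 0)
        - (Complex.I * (y : ℂ)) • (1 : Matrix (Fin n) (Fin n) ℂ)).det
      = (-Complex.I) ^ n *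
          (((y : ℂ) - (x : ℂ)) * ∏ i ∈ Finset.range (n - 1), ((y : ℂ) - (μ i : ℂ))
            - ∑ j ∈ Finset.range (n - 1),
                (Complex.normSq (z j) : ℂ) *
                  ∏ i ∈ (Finset.range (n - 1)).erase j, ((y : ℂ) - (μ i : ℂ))) := by
  obtain ⟨m, rfl⟩ := Nat.exists_eq_add_of_le' hn
  simp only [Nat.add_sub_cancel]
  rw [← Matrix.det_submatrix_equiv_self (finSumFinEquiv (m := m) (n := 1))]
  have hblocks := det_fromBlocks_diagonal_border
    (fun i : Fin m => -Complex.I * ((y : ℂ) - (μ i : ℂ)))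
    (Matrix.of fun i _ => -z i) (Matrix.of fun _ j => (starRingEnd ℂ) (z j))
    (-Complex.I * ((y : ℂ) - (x : ℂ)))
  have herase : ∀ j : Fin m, ∏ i ∈ Finset.univ.erase j, ((y : ℂ) - (μ i : ℂ))
      = ∏ i ∈ (Finset.range m).erase j, ((y : ℂ) - (μ i : ℂ)) := by
    intro j
    refine Finset.prod_bij (fun i _ => (i : ℕ)) ?_ ?_ ?_ ?_
    · intro i hi
      simpa [Fin.ext_iff] using hi
    · intro i _ k _ h
      exact Fin.ext h
    · intro k hk
      simp only [Finset.mem_erase, Finset.mem_range] at hk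
      exact ⟨⟨k, hk.2⟩, by simpa [Fin.ext_iff] using hk.1, rfl⟩
    · intro i _
      rfl
  convert hblocks using 1
  · congr 1
    ext i j
    rcases i with i | i <;> rcases j with j | j
    · by_cases h : i = j
      · subst h
        simp [i.isLt.ne]
        ring
      · have h' : Fin.castAdd 1 i ≠ Fin.castAdd 1 j := by simpa using h
        simp [h, i.isLt.ne, j.isLt.ne]
    · have h' : Fin.castAdd 1 i ≠ Fin.natAdd m j := by
        simp [Fin.ext_iff, i.isLt.ne]
      simp [h']
    · have h' : Fin.natAdd m i ≠ Fin.castAdd 1 j := by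
        simp [Fin.ext_iff, j.isLt.ne']
      simp [h']
    · obtain rfl := Subsingleton.elim i 0
      obtain rfl := Subsingleton.elim j 0
      simp
      ring
  · rw [Finset.prod_mul_distrib, Finset.prod_const, Finset.card_univ, Fintype.card_fin,
      ← Fin.prod_univ_eq_prod_range (fun i => (y : ℂ) - (μ i : ℂ)),
      ← Fin.sum_univ_eq_sum_range (fun j => (Complex.normSq (z j) : ℂ) *
        ∏ i ∈ (Finset.range m).erase j, ((y : ℂ) - (μ i : ℂ))), mul_sub, Finset.mul_sum]
    congr 1
    · ring
    · refine Finset.sum_congr rfl fun j _ => ?_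
      obtain ⟨k, rfl⟩ : ∃ k, m = k + 1 := Nat.exists_eq_add_of_le' j.pos
      rw [Finset.prod_mul_distrib, Finset.prod_const, Finset.card_erase_of_mem (Finset.mem_univ j),
        Finset.card_univ, Fintype.card_fin, herase, Complex.normSq_eq_conj_mul_self,
        Nat.add_sub_cancel]
      have hI : (-Complex.I) ^ (k + 1 + 1) = -(-Complex.I) ^ k := by
        rw [pow_succ, pow_succ, mul_assoc, neg_mul_neg, Complex.I_mul_I, mul_neg_one]
      rw [hI]
      simp only [Matrix.of_apply]
      ring
end

section
/- Let n ≥ 1, μ ∈ P_{n−1} and λ ∈ P_n. Then λ₁ ≥ μ₁ ≥ λ₂ ≥ μ₂ ≥ … ≥ μ_{n−1} ≥ λₙ holds if and only if there exist a matrix B ∈ W and a unitary matrix A ∈ U(n) such that A(J_μ + B)A* = J_λ. -/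
open Matrix

theorem exists_partialFraction_of_interlacing (m : ℕ) (μ lam : ℕ → ℝ)
    (hμ : ∀ i, i + 1 < m → μ (i + 1) ≤ μ i)
    (h : ∀ j < m, μ j ≤ lam j ∧ lam (j + 1) ≤ μ j) :
    ∃ (c : ℝ) (w : ℕ → ℝ), (∀ i, 0 ≤ w i) ∧ ∀ x : ℝ, (∀ i < m, x ≠ μ i) →
      ∏ i ∈ Finset.range (m + 1), (x - lam i) =
        (∏ i ∈ Finset.range m, (x - μ i)) *
          (x - c - ∑ i ∈ Finset.range m, w i / (x - μ i)) := by
  induction m generalizing lam with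
  | zero => exact ⟨lam 0, 0, by simp, by simp⟩
  | succ m ih =>
    have hμ' : ∀ i, i + 1 < m → μ (i + 1) ≤ μ i := fun i hi => hμ i (by omega)
    by_cases hlast : ∃ k, m = k + 1 ∧ μ k = μ m
    · obtain ⟨k, rfl, hk⟩ := hlast
      have hl : lam (k + 1) = μ (k + 1) :=
        le_antisymm (hk ▸ (h k (by omega)).2) (h (k + 1) (by omega)).1
      obtain ⟨c, w, hw, hf⟩ := ih (Function.update lam (k + 1) (lam (k + 2))) hμ' (by
        intro j hj
        rw [Function.update_of_ne (by omega)]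
        refine ⟨(h j (by omega)).1, ?_⟩
        by_cases hjk : j = k
        · subst hjk
          rw [Function.update_self, hk]
          exact (h (j + 1) (by omega)).2
        · rw [Function.update_of_ne (by omega)]
          exact (h j (by omega)).2)
      refine ⟨c, Function.update w (k + 1) 0, ?_, fun x hx => ?_⟩
      · intro i
        by_cases hi : i = k + 1
        · simp [hi]
        · simpa [Function.update_of_ne hi] using hw i
      · have h1 := hf x fun i hi => hx i (by omega)
        rw [Finset.prod_range_succ, Function.update_self] at h1
        rw [Finset.prod_congr rfl (g := fun i => x - lam i) (by
          intro i hi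
          rw [Function.update_of_ne (Finset.mem_range.1 hi).ne])] at h1
        have h2 : ∑ i ∈ Finset.range (k + 1), Function.update w (k + 1) 0 i / (x - μ i) =
            ∑ i ∈ Finset.range (k + 1), w i / (x - μ i) :=
          Finset.sum_congr rfl fun i hi => by
            rw [Function.update_of_ne (Finset.mem_range.1 hi).ne]
        rw [Finset.prod_range_succ, Finset.prod_range_succ, Finset.sum_range_succ,
          Finset.prod_range_succ (fun i => x - μ i) (k + 1), h2, Function.update_self, hl]
        linear_combination (x - μ (k + 1)) * h1
    · have hlt : ∀ i < m, μ m < μ i := by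
        intro i hi
        obtain ⟨k, rfl⟩ : ∃ k, m = k + 1 := ⟨m - 1, by omega⟩
        have hk : μ (k + 1) < μ k :=
          lt_of_le_of_ne (hμ k (by omega)) fun e => hlast ⟨k, rfl, e.symm⟩
        refine hk.trans_le ?_
        have key : ∀ d, i + d ≤ k → μ (i + d) ≤ μ i := by
          intro d
          induction d with
          | zero => simp
          | succ d ihd =>
            intro hd
            exact (hμ (i + d) (by omega)).trans (ihd (by omega))
        have := key (k - i) (by omega)
        rwa [show i + (k - i) = k by omega] at this
      obtain ⟨c, w, hw, hf⟩ := ih lam hμ' fun j hj => h j (by omega)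
      set r := μ m - c - ∑ i ∈ Finset.range m, w i / (μ m - μ i) with hr
      have hm := h m (by omega)
      have hr0 : r ≤ 0 := by
        have h1 := hf (μ m) fun i hi => (hlt i hi).ne
        rw [← hr, Finset.prod_range_succ'] at h1
        have hg : ∏ i ∈ Finset.range m, (μ m - μ i) ≠ 0 :=
          Finset.prod_ne_zero_iff.2 fun i hi =>
            sub_ne_zero.2 (hlt i (Finset.mem_range.1 hi)).ne
        have h2 : r = (∏ i ∈ Finset.range m, (μ m - lam (i + 1)) / (μ m - μ i)) *
            (μ m - lam 0) := by
          rw [Finset.prod_div_distrib]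
          field_simp
          linear_combination -h1
        have hle : ∀ i ≤ m, μ m ≤ lam i := by
          intro i hi
          rcases hi.eq_or_lt with rfl | hi
          · exact hm.1
          · exact (hlt i hi).le.trans (h i (by omega)).1
        rw [h2]
        refine mul_nonpos_of_nonneg_of_nonpos (Finset.prod_nonneg fun i hi => ?_)
          (sub_nonpos.2 (hle 0 (by omega)))
        have hi' := Finset.mem_range.1 hi
        exact div_nonneg_of_nonpos (sub_nonpos.2 (hle _ (by omega)))
          (sub_nonpos.2 (hlt i hi').le)
      refine ⟨c - (μ m - lam (m + 1)), fun i => if i < m then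
        w i * ((μ i - lam (m + 1)) / (μ i - μ m)) else -((μ m - lam (m + 1)) * r), ?_, ?_⟩
      · intro i
        dsimp only
        split_ifs with hi
        · have := hlt i hi
          exact mul_nonneg (hw i) (div_nonneg (by linarith [hm.2]) (by linarith))
        · have := mul_nonneg (sub_nonneg.2 hm.2) (neg_nonneg.2 hr0)
          linarith
      · intro x hx
        dsimp only
        have hxm : x - μ m ≠ 0 := sub_ne_zero.2 (hx m (by omega))
        rw [Finset.prod_range_succ, hf x fun i hi => hx i (by omega),
          Finset.prod_range_succ (fun i => x - μ i) m, Finset.sum_range_succ,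
          if_neg (lt_irrefl m)]
        have hs : ∑ i ∈ Finset.range m, (if i < m then
              w i * ((μ i - lam (m + 1)) / (μ i - μ m)) else
                -((μ m - lam (m + 1)) * r)) / (x - μ i) =
            (x - lam (m + 1)) / (x - μ m) * ∑ i ∈ Finset.range m, w i / (x - μ i) -
              (μ m - lam (m + 1)) / (x - μ m) *
                ∑ i ∈ Finset.range m, w i / (μ m - μ i) := by
          rw [Finset.mul_sum, Finset.mul_sum, ← Finset.sum_sub_distrib]
          refine Finset.sum_congr rfl fun i hi => ?_
          have hi' := Finset.mem_range.1 hi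
          have h1 : x - μ i ≠ 0 := sub_ne_zero.2 (hx i (by omega))
          have h2 : μ i - μ m ≠ 0 := sub_ne_zero.2 (hlt i hi').ne'
          have h3 : μ m - μ i ≠ 0 := sub_ne_zero.2 (hlt i hi').ne
          rw [if_pos hi', ← neg_sub (μ i) (μ m)]
          field_simp
          ring
        rw [hs, hr]
        field_simp
        ring

theorem Matrix.IsHermitian.exists_unitary_conj_eq_of_charpoly_eq {ι 𝕜 : Type*} [RCLike 𝕜]
    [Fintype ι] [DecidableEq ι] {H K : Matrix ι ι 𝕜} (hH : H.IsHermitian) (hK : K.IsHermitian)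
    (h : H.charpoly = K.charpoly) :
    ∃ A ∈ Matrix.unitaryGroup ι 𝕜, A * H * Aᴴ = K := by
  have he := (hH.eigenvalues_eq_eigenvalues_iff hK).2 h
  refine ⟨_, (hK.eigenvectorUnitary * star hH.eigenvectorUnitary).2, ?_⟩
  have h1 := hH.conjStarAlgAut_star_eigenvectorUnitary
  rw [Unitary.conjStarAlgAut_star_apply] at h1
  have h2 := hK.spectral_theorem
  rw [Unitary.conjStarAlgAut_apply, ← he, ← h1] at h2
  conv_rhs => rw [h2]
  simp [← star_eq_conjTranspose, mul_assoc]

theorem Matrix.det_fromBlocks_diagonal_replicateCol_replicateRow {K : Type*} [Field K] {ι : Type*}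
    [Fintype ι] [DecidableEq ι] (d u v : ι → K) (s : K) (hd : ∀ i, d i ≠ 0) :
    (fromBlocks (diagonal d) (replicateCol (Fin 1) u) (replicateRow (Fin 1) v)
      (diagonal fun _ => s)).det = (∏ i, d i) * (s - ∑ i, v i * u i / d i) := by
  let _ : Invertible (diagonal d) := ⟨diagonal fun i => (d i)⁻¹, by
    simp [diagonal_mul_diagonal, hd], by simp [diagonal_mul_diagonal, hd]⟩
  rw [det_fromBlocks₁₁, det_diagonal, det_fin_one]
  change _ * (_ - ((replicateRow (Fin 1) v * diagonal fun i => (d i)⁻¹) *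
    replicateCol (Fin 1) u) 0 0) = _
  congr 2
  rw [mul_apply]
  refine Finset.sum_congr rfl fun i _ => ?_
  rw [mul_diagonal]
  simp only [replicateRow_apply, replicateCol_apply]
  ring

theorem Matrix.exists_bordered_diagonal_conj_eq_diagonal (m : ℕ) (μ lam : ℕ → ℝ)
    (hμ : ∀ i, i + 1 < m → μ (i + 1) ≤ μ i)
    (h : ∀ j < m, μ j ≤ lam j ∧ lam (j + 1) ≤ μ j) :
    ∃ A H : Matrix (Fin (m + 1)) (Fin (m + 1)) ℂ, A ∈ unitaryGroup (Fin (m + 1)) ℂ ∧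
      H.IsHermitian ∧
      (∀ i j : Fin m, H i.castSucc j.castSucc = diagonal (fun i : Fin m => (μ i : ℂ)) i j) ∧
      A * H * Aᴴ = diagonal fun i : Fin (m + 1) => (lam i : ℂ) := by
  obtain ⟨c, w, hw, hf⟩ := exists_partialFraction_of_interlacing m μ lam hμ h
  set z : Fin m → ℂ := fun i => ((Real.sqrt (w i) : ℝ) : ℂ) with hz
  set M : Matrix (Fin m ⊕ Fin 1) (Fin m ⊕ Fin 1) ℂ :=
    fromBlocks (diagonal fun i : Fin m => (μ i : ℂ)) (replicateCol (Fin 1) z)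
      (replicateRow (Fin 1) z) (diagonal fun _ => (c : ℂ)) with hM
  have hMH : M.IsHermitian := by
    refine IsHermitian.fromBlocks ?_ ?_ ?_
    · exact isHermitian_diagonal_of_self_adjoint _ (by ext i; simp)
    · ext i j
      simp [hz]
    · exact isHermitian_diagonal_of_self_adjoint _ (by ext i; simp)
  have hHH : (M.submatrix finSumFinEquiv.symm finSumFinEquiv.symm).IsHermitian :=
    hMH.submatrix _
  have hKH : (diagonal fun i : Fin (m + 1) => (lam i : ℂ)).IsHermitian :=
    isHermitian_diagonal_of_self_adjoint _ (by ext i; simp)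
  have hchar : (M.submatrix finSumFinEquiv.symm finSumFinEquiv.symm).charpoly =
      (diagonal fun i : Fin (m + 1) => (lam i : ℂ)).charpoly := by
    rw [← reindex_apply, charpoly_reindex]
    apply Polynomial.eq_of_infinite_eval_eq
    have hfin : ((Finset.range m).image μ : Set ℝ).Finite := Finset.finite_toSet _
    refine (hfin.infinite_compl.image Complex.ofReal_injective.injOn).mono ?_
    rintro _ ⟨x, hx, rfl⟩
    have hx' : ∀ i < m, x ≠ μ i := by
      rintro i hi rfl
      exact hx (by simpa using ⟨i, hi, rfl⟩)
    have hfx := congrArg (Complex.ofReal) (hf x hx')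
    have hsub : scalar (Fin m ⊕ Fin 1) (x : ℂ) - M =
        fromBlocks (diagonal fun i : Fin m => (x : ℂ) - μ i) (replicateCol (Fin 1) (-z))
          (replicateRow (Fin 1) (-z)) (diagonal fun _ => (x : ℂ) - c) := by
      ext (i | i) (j | j)
      · by_cases hij : i = j <;> simp [hM, hij]
      · simp [hM]
      · simp [hM]
      · simp [hM, Subsingleton.elim i j]
    rw [Set.mem_ofPred_eq, eval_charpoly, hsub,
      det_fromBlocks_diagonal_replicateCol_replicateRow, charpoly_diagonal,
      Polynomial.eval_prod]
    · simp only [Polynomial.eval_sub, Polynomial.eval_X, Polynomial.eval_C]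
      rw [Fin.prod_univ_eq_prod_range (fun i => (x : ℂ) - μ i),
        Fin.prod_univ_eq_prod_range (fun i => (x : ℂ) - lam i)]
      push_cast at hfx
      rw [hfx, ← Fin.sum_univ_eq_sum_range (fun i => (w i : ℂ) / (x - μ i))]
      congr 2
      refine Finset.sum_congr rfl fun i _ => ?_
      simp only [hz, Pi.neg_apply, neg_mul_neg]
      rw [← Complex.ofReal_mul, Real.mul_self_sqrt (hw i)]
    · intro i
      rw [← Complex.ofReal_sub]
      exact_mod_cast sub_ne_zero.2 (hx' i i.2)
  obtain ⟨A, hA, hAH⟩ := hHH.exists_unitary_conj_eq_of_charpoly_eq hKH hchar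
  refine ⟨A, _, hA, hHH, fun i j => ?_, hAH⟩
  have : ∀ i : Fin m, finSumFinEquiv.symm i.castSucc = (Sum.inl i : Fin m ⊕ Fin 1) :=
    fun i => finSumFinEquiv_symm_apply_castAdd i
  simp [this, hM]

theorem Matrix.exists_ne_zero_forall_ne_mulVec_eq_zero {K : Type*} [Field K] {ι : Type*}
    [Fintype ι] [DecidableEq ι] (M : Matrix ι ι K) (k : ι) :
    ∃ x ≠ 0, ∀ i ≠ k, (M *ᵥ x) i = 0 := by
  obtain ⟨x, hx, h⟩ := exists_mulVec_eq_zero_iff.2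
    (det_eq_zero_of_row_eq_zero (A := M.updateRow k 0) k (by simp))
  refine ⟨x, hx, fun i hi => ?_⟩
  have := congrFun h i
  simpa [mulVec, updateRow_ne hi] using this

theorem Matrix.sum_mul_normSq_eq_of_unitary_conj_eq_diagonal {ι : Type*} [Fintype ι] [DecidableEq ι]
    {A B : Matrix ι ι ℂ} (hA : A ∈ unitaryGroup ι ℂ) {d l : ι → ℝ}
    (h : A * (diagonal (fun i => Complex.I * d i) + B) * Aᴴ =
      diagonal fun i => Complex.I * l i) (x : ι → ℂ)
    (hB : ∀ i j, x i ≠ 0 → x j ≠ 0 → B i j = 0) :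
    ∑ i, d i * Complex.normSq (x i) = ∑ i, l i * Complex.normSq ((A *ᵥ x) i) := by
  have hAA : Aᴴ * A = 1 := mem_unitaryGroup_iff'.1 hA
  have h1 : diagonal (fun i => Complex.I * d i) + B =
      Aᴴ * diagonal (fun i => Complex.I * (l i : ℂ)) * A := by
    rw [← h]
    simp only [mul_assoc, hAA, mul_one]
    rw [← mul_assoc, hAA, one_mul]
  have hdiag : ∀ (e : ι → ℝ) (y : ι → ℂ),
      star y ⬝ᵥ (diagonal (fun i => Complex.I * (e i : ℂ)) *ᵥ y) =
        Complex.I * ((∑ i, e i * Complex.normSq (y i) : ℝ) : ℂ) := by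
    intro e y
    simp only [dotProduct, mulVec_diagonal, Pi.star_apply]
    push_cast
    rw [Finset.mul_sum]
    refine Finset.sum_congr rfl fun i _ => ?_
    rw [Complex.normSq_eq_conj_mul_self]
    simp only [RCLike.star_def]
    ring
  have hBx : star x ⬝ᵥ (B *ᵥ x) = 0 := by
    simp only [dotProduct, mulVec, Pi.star_apply]
    refine Finset.sum_eq_zero fun i _ => ?_
    by_cases hi : x i = 0
    · simp [hi]
    · rw [Finset.sum_eq_zero, mul_zero]
      intro j _
      by_cases hj : x j = 0
      · simp [hj]
      · simp [hB i j hi hj]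
  have h2 : star x ⬝ᵥ ((diagonal (fun i => Complex.I * d i) + B) *ᵥ x) =
      star (A *ᵥ x) ⬝ᵥ (diagonal (fun i => Complex.I * (l i : ℂ)) *ᵥ (A *ᵥ x)) := by
    rw [h1, star_mulVec, ← mulVec_mulVec, ← mulVec_mulVec, ← dotProduct_mulVec]
  rw [add_mulVec, dotProduct_add, hBx, add_zero, hdiag, hdiag] at h2
  exact_mod_cast mul_left_cancel₀ Complex.I_ne_zero h2

theorem Matrix.sum_normSq_mulVec_of_mem_unitaryGroup {ι : Type*} [Fintype ι] [DecidableEq ι]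
    {A : Matrix ι ι ℂ} (hA : A ∈ unitaryGroup ι ℂ) (x : ι → ℂ) :
    ∑ i, Complex.normSq ((A *ᵥ x) i) = ∑ i, Complex.normSq (x i) := by
  have h := sum_mul_normSq_eq_of_unitary_conj_eq_diagonal (B := 0) hA
    (d := fun _ => 1) (l := fun _ => 1) ?_ x (by simp)
  · simpa using h.symm
  · have hAA : A * Aᴴ = 1 := mem_unitaryGroup_iff.1 hA
    rw [add_zero, ← smul_one_eq_diagonal]
    simp [hAA]

theorem sum_normSq_pos_of_ne_zero {ι : Type*} [Fintype ι] {x : ι → ℂ} (hx : x ≠ 0) :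
    0 < ∑ i, Complex.normSq (x i) := by
  obtain ⟨i, hi⟩ := Function.ne_iff.1 hx
  exact Finset.sum_pos' (fun i _ => Complex.normSq_nonneg _)
    ⟨i, Finset.mem_univ _, Complex.normSq_pos.2 hi⟩

theorem Matrix.le_of_unitary_conj_eq_diagonal {ι : Type*} [Fintype ι] [DecidableEq ι]
    {A B : Matrix ι ι ℂ} (hA : A ∈ unitaryGroup ι ℂ) {d l : ι → ℝ}
    (h : A * (diagonal (fun i => Complex.I * d i) + B) * Aᴴ =
      diagonal fun i => Complex.I * l i) {x : ι → ℂ} (hx : x ≠ 0)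
    (hB : ∀ i j, x i ≠ 0 → x j ≠ 0 → B i j = 0) {a b : ℝ}
    (ha : ∀ i, x i ≠ 0 → a ≤ d i) (hb : ∀ i, (A *ᵥ x) i ≠ 0 → l i ≤ b) : a ≤ b := by
  refine le_of_mul_le_mul_right ?_ (sum_normSq_pos_of_ne_zero hx)
  calc a * ∑ i, Complex.normSq (x i) ≤ ∑ i, d i * Complex.normSq (x i) := by
        rw [Finset.mul_sum]
        refine Finset.sum_le_sum fun i _ => ?_
        by_cases hi : x i = 0
        · simp [hi]
        · exact mul_le_mul_of_nonneg_right (ha i hi) (Complex.normSq_nonneg _)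
    _ = ∑ i, l i * Complex.normSq ((A *ᵥ x) i) :=
        sum_mul_normSq_eq_of_unitary_conj_eq_diagonal hA h x hB
    _ ≤ b * ∑ i, Complex.normSq (x i) := by
        rw [← sum_normSq_mulVec_of_mem_unitaryGroup hA x, Finset.mul_sum]
        refine Finset.sum_le_sum fun i _ => ?_
        by_cases hi : (A *ᵥ x) i = 0
        · simp [hi]
        · exact mul_le_mul_of_nonneg_right (hb i hi) (Complex.normSq_nonneg _)

theorem Nat.antitone_lt_of_succ_le {α : Type*} [Preorder α] {N : ℕ} {f : ℕ → α}
    (hf : ∀ i, i + 1 < N → f (i + 1) ≤ f i) {i j : ℕ} (hij : i ≤ j) (hj : j < N) :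
    f j ≤ f i := by
  induction j, hij using Nat.le_induction with
  | base => exact le_rfl
  | succ k _ ih => exact (hf k hj).trans (ih (by omega))

theorem stmt2 (n : ℕ) (hn : 1 ≤ n) (μ : ℕ → ℤ) (lam : ℕ → ℤ)
    (hμ : ∀ i, i + 1 < n - 1 → μ (i + 1) ≤ μ i)
    (hlam : ∀ i, i + 1 < n → lam (i + 1) ≤ lam i) :
    (∀ j < n - 1, μ j ≤ lam j ∧ lam (j + 1) ≤ μ j)
      ↔ ∃ (A B : Matrix (Fin n) (Fin n) ℂ),
          A ∈ Matrix.unitaryGroup (Fin n) ℂ ∧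
          Bᴴ = -B ∧
          (∀ i j : Fin n, (i : ℕ) < n - 1 → (j : ℕ) < n - 1 → B i j = 0) ∧
          A * (Matrix.diagonal (fun i : Fin n =>
              if (i : ℕ) < n - 1 then Complex.I * (μ (i : ℕ) : ℂ) else 0) + B) * Aᴴ
            = Matrix.diagonal (fun i : Fin n => Complex.I * (lam (i : ℕ) : ℂ)) := by
  obtain ⟨m, rfl⟩ : ∃ m, n = m + 1 := ⟨n - 1, by omega⟩
  rw [Nat.add_sub_cancel] at hμ ⊢
  set D : Matrix (Fin (m + 1)) (Fin (m + 1)) ℂ := diagonal (fun i : Fin (m + 1) =>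
    if (i : ℕ) < m then Complex.I * (μ (i : ℕ) : ℂ) else 0) with hD
  have hD' : D = diagonal fun i : Fin (m + 1) =>
      Complex.I * (((if (i : ℕ) < m then (μ i : ℝ) else 0 : ℝ)) : ℂ) := by
    rw [hD]
    congr 1
    ext i
    split_ifs <;> simp
  constructor
  · intro h
    obtain ⟨A, H, hA, hH, hHμ, hAH⟩ := exists_bordered_diagonal_conj_eq_diagonal m
      (fun i => (μ i : ℝ)) (fun i => (lam i : ℝ)) (fun i hi => by exact_mod_cast hμ i hi)
      (fun j hj => by exact_mod_cast h j hj)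
    refine ⟨A, Complex.I • H - D, hA, ?_, fun i j hi hj => ?_, ?_⟩
    · have hDs : Dᴴ = -D := by
        rw [hD', diagonal_conjTranspose, diagonal_neg]
        congr 1
        ext i
        simp
      rw [conjTranspose_sub, conjTranspose_smul, hH.eq, hDs]
      simp
      abel
    · have h1 := hHμ ⟨i, hi⟩ ⟨j, hj⟩
      simp only [Fin.castSucc_mk, Fin.eta, diagonal_apply, Fin.mk.injEq] at h1
      rw [Matrix.sub_apply, Matrix.smul_apply, h1, hD, diagonal_apply]
      by_cases hij : i = j
      · subst hij
        simp [hi]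
      · simp [hij, Fin.val_ne_of_ne hij]
    · rw [add_sub_cancel, mul_smul_comm, smul_mul_assoc, hAH, ← diagonal_smul]
      congr 1
  · rintro ⟨A, B, hA, -, hB, h⟩ j hj
    rw [hD'] at h
    have h' : A * (diagonal (fun i : Fin (m + 1) =>
        Complex.I * (((if (i : ℕ) < m then (μ i : ℝ) else 0 : ℝ)) : ℂ)) + B) * Aᴴ =
        diagonal fun i : Fin (m + 1) => Complex.I * ((lam i : ℝ) : ℂ) := by
      simpa using h
    have hn' : A * (diagonal (fun i : Fin (m + 1) =>
        Complex.I * ((-(if (i : ℕ) < m then (μ i : ℝ) else 0) : ℝ) : ℂ)) + -B) * Aᴴ =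
        diagonal fun i : Fin (m + 1) => Complex.I * ((-(lam i : ℝ) : ℝ) : ℂ) := by
      have h2 := congrArg Neg.neg h'
      rw [← neg_mul, ← mul_neg, neg_add, diagonal_neg, diagonal_neg] at h2
      simpa using h2
    constructor
    · obtain ⟨x, hx, hx0⟩ := exists_ne_zero_forall_ne_mulVec_eq_zero
        (Matrix.of fun i : Fin (m + 1) => if (i : ℕ) < j then A i else Pi.single i 1) ⟨j, by omega⟩
      have hxi : ∀ i, x i ≠ 0 → (i : ℕ) ≤ j := by
        intro i hi
        by_contra! hlt
        have := hx0 i (by rintro rfl; simp at hlt)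
        simp [mulVec, show ¬ (i : ℕ) < j by omega] at this
        exact hi this
      have hAx : ∀ i, (A *ᵥ x) i ≠ 0 → j ≤ (i : ℕ) := by
        intro i hi
        by_contra! hlt
        have := hx0 i (by rintro rfl; simp at hlt)
        simp [mulVec, hlt] at this
        exact hi this
      have key : (μ j : ℝ) ≤ lam j := by
        refine le_of_unitary_conj_eq_diagonal hA h' hx
          (fun i k hi hk => hB i k (by have := hxi i hi; omega) (by have := hxi k hk; omega))
          (fun i hi => ?_) (fun i hi => ?_)
        · have := hxi i hi
          rw [if_pos (by omega)]
          exact_mod_cast Nat.antitone_lt_of_succ_le hμ this hj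
        · exact_mod_cast Nat.antitone_lt_of_succ_le hlam (hAx i hi) i.2
      exact_mod_cast key
    · obtain ⟨x, hx, hx0⟩ := exists_ne_zero_forall_ne_mulVec_eq_zero
        (Matrix.of fun i : Fin (m + 1) => if (i : ℕ) < j then Pi.single i 1 else
          if (i : ℕ) = j then Pi.single (Fin.last m) 1 else A i) ⟨j + 1, by omega⟩
      have hxi : ∀ i, x i ≠ 0 → j ≤ (i : ℕ) ∧ (i : ℕ) < m := by
        intro i hi
        refine ⟨?_, ?_⟩
        · by_contra! hlt
          have := hx0 i (by rintro rfl; simp at hlt)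
          simp [mulVec, hlt] at this
          exact hi this
        · by_contra! hlt
          have := hx0 ⟨j, by omega⟩ (by simp)
          simp [mulVec] at this
          rw [show i = Fin.last m from Fin.ext (by simp; omega)] at hi
          exact hi this
      have hAx : ∀ i, (A *ᵥ x) i ≠ 0 → (i : ℕ) ≤ j + 1 := by
        intro i hi
        by_contra! hlt
        have := hx0 i (by rintro rfl; simp at hlt)
        simp [mulVec, show ¬ (i : ℕ) < j by omega, show ¬ (i : ℕ) = j by omega] at this
        exact hi this
      have key : -(μ j : ℝ) ≤ -lam (j + 1) := by
        refine le_of_unitary_conj_eq_diagonal hA hn' hx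
          (fun i k hi hk => by simp [hB i k (hxi i hi).2 (hxi k hk).2])
          (fun i hi => ?_) (fun i hi => ?_)
        · rw [if_pos (hxi i hi).2]
          exact neg_le_neg (by exact_mod_cast Nat.antitone_lt_of_succ_le hμ (hxi i hi).1 (hxi i hi).2)
        · exact neg_le_neg (by
            exact_mod_cast Nat.antitone_lt_of_succ_le hlam (hAx i hi) (by omega))
      exact_mod_cast neg_le_neg_iff.1 key
end

section
/- Let n ≥ 1 and let λ, β ∈ P_n. If β₁ ≥ λ₁ ≥ β₂ ≥ λ₂ ≥ … ≥ βₙ ≥ λₙ, then there exists z ∈ ℂ^n such that the Hermitian matrix diag(λ₁,…,λₙ) + zz* has eigenvalues β₁,…,βₙ (with multiplicity). If λ₁ ≥ β₁ ≥ λ₂ ≥ β₂ ≥ … ≥ λₙ ≥ βₙ, then there exists z ∈ ℂ^n such that diag(λ₁,…,λₙ) − zz* has eigenvalues β₁,…,βₙ (with multiplicity). -/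
open Matrix Polynomial

section Interlacing

variable {ι : Type*} [DecidableEq ι]

/-- Partial fraction decomposition with nonnegative coefficients, distinct nodes. -/
theorem exists_nonneg_prod_X_sub_C_eq_of_injOn (s : Finset ι) (a b : ι → ℝ) {ε : ℝ}
    (hε : ε * ε = 1) (hab : ∀ i ∈ s, 0 ≤ ε * (b i - a i))
    (hsign : ∀ i ∈ s, ∀ j ∈ s, i ≠ j → 0 ≤ (a i - b j) / (a i - a j))
    (hinj : Set.InjOn a s) :
    ∃ c : ι → ℝ, (∀ i, 0 ≤ c i) ∧
      ∏ i ∈ s, (X - C (b i)) =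
        ∏ i ∈ s, (X - C (a i)) - ∑ i ∈ s, C (ε * c i) * ∏ j ∈ s.erase i, (X - C (a j)) := by
  let w : ι → ℝ := fun i => ε * (b i - a i) * ∏ j ∈ s.erase i, ((a i - b j) / (a i - a j))
  have hw : ∀ i ∈ s, 0 ≤ w i := fun i hi =>
    mul_nonneg (hab i hi) <| Finset.prod_nonneg fun j hj =>
      hsign i hi j (Finset.mem_of_mem_erase hj) (Finset.ne_of_mem_erase hj).symm
  refine ⟨fun i => if i ∈ s then w i else 0, fun i => ?_, ?_⟩
  · dsimp only
    split_ifs with hi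
    exacts [hw i hi, le_rfl]
  rcases s.eq_empty_or_nonempty with rfl | hs
  · simp
  have hcard : (∏ i ∈ s, (X - C (a i))).degree = (s.card : WithBot ℕ) := by
    simp [degree_prod]
  have hcard' : (∏ i ∈ s, (X - C (b i))).degree = (s.card : WithBot ℕ) := by
    simp [degree_prod]
  have hmonic (f : ι → ℝ) : (∏ i ∈ s, (X - C (f i))).Monic := monic_prod_X_sub_C f s
  suffices h : ∏ i ∈ s, (X - C (a i)) - ∏ i ∈ s, (X - C (b i)) =
      ∑ i ∈ s, C (ε * if i ∈ s then w i else 0) * ∏ j ∈ s.erase i, (X - C (a j)) by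
    rw [← h, sub_sub_cancel]
  refine eq_of_degrees_lt_of_eval_index_eq s hinj ?_ ?_ fun k hk => ?_
  · rw [← hcard]
    exact degree_sub_lt_left (hcard.trans hcard'.symm) (hmonic a).ne_zero
      ((hmonic a).leadingCoeff.trans (hmonic b).leadingCoeff.symm)
  · refine (degree_sum_le _ _).trans_lt ((Finset.sup_lt_iff (WithBot.bot_lt_coe _)).2 fun i hi => ?_)
    refine (degree_mul_le_of_le degree_C_le le_rfl).trans_lt ?_
    simp only [degree_prod, degree_X_sub_C, Finset.sum_const, nsmul_eq_mul, mul_one,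
      zero_add]
    exact_mod_cast Finset.card_erase_lt_of_mem hi
  have hne : ∏ j ∈ s.erase k, (a k - a j) ≠ 0 := Finset.prod_ne_zero_iff.2 fun j hj =>
    sub_ne_zero.2 fun h =>
      Finset.ne_of_mem_erase hj (hinj hk (Finset.mem_of_mem_erase hj) h).symm
  simp only [eval_sub, eval_prod, eval_finsetSum, eval_mul, eval_X, eval_C]
  rw [Finset.sum_eq_single_of_mem k hk fun i _ hik => by
      rw [Finset.prod_eq_zero (Finset.mem_erase.2 ⟨hik.symm, hk⟩) (sub_self (a k)), mul_zero],
    Finset.prod_eq_zero hk (sub_self (a k)), ← Finset.mul_prod_erase s _ hk, if_pos hk]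
  simp only [w, Finset.prod_div_distrib]
  field_simp
  linear_combination (a k - b k) * (∏ j ∈ s.erase k, (a k - b j)) * hε

/-- Partial fraction decomposition with nonnegative coefficients for interlacing roots. -/
theorem exists_nonneg_prod_X_sub_C_eq (s : Finset ι) (a b : ι → ℝ) {ε : ℝ}
    (hε : ε * ε = 1) (hab : ∀ i ∈ s, 0 ≤ ε * (b i - a i))
    (hsign : ∀ i ∈ s, ∀ j ∈ s, i ≠ j → 0 ≤ (a i - b j) / (a i - a j))
    (hrep : ∀ i ∈ s, ∀ j ∈ s, i ≠ j → a i = a j → b i = a i ∨ b j = a j) :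
    ∃ c : ι → ℝ, (∀ i, 0 ≤ c i) ∧
      ∏ i ∈ s, (X - C (b i)) =
        ∏ i ∈ s, (X - C (a i)) - ∑ i ∈ s, C (ε * c i) * ∏ j ∈ s.erase i, (X - C (a j)) := by
  induction s using Finset.strongInduction with
  | H s ih =>
  by_cases hinj : Set.InjOn a s
  · exact exists_nonneg_prod_X_sub_C_eq_of_injOn s a b hε hab hsign hinj
  obtain ⟨k, hk, hbk⟩ : ∃ k ∈ s, b k = a k := by
    simp only [Set.InjOn, not_forall] at hinj
    obtain ⟨i, hi, j, hj, hij, hne⟩ := hinj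
    rcases hrep i hi j hj hne hij with h | h
    exacts [⟨i, hi, h⟩, ⟨j, hj, h⟩]
  have hmem : ∀ i ∈ s.erase k, i ∈ s := fun i => Finset.mem_of_mem_erase
  obtain ⟨c, hc, heq⟩ := ih (s.erase k) (Finset.erase_ssubset hk)
    (fun i hi => hab i (hmem i hi))
    (fun i hi j hj => hsign i (hmem i hi) j (hmem j hj))
    (fun i hi j hj => hrep i (hmem i hi) j (hmem j hj))
  refine ⟨Function.update c k 0, fun i => ?_, ?_⟩
  · rcases eq_or_ne i k with rfl | h <;> simp [*]
  rw [← Finset.mul_prod_erase s _ hk, ← Finset.mul_prod_erase s (fun i => X - C (a i)) hk,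
    ← Finset.add_sum_erase s _ hk, heq, hbk, mul_sub, Finset.mul_sum]
  simp only [Function.update_self, mul_zero, C_0, zero_mul, zero_add]
  congr 1
  refine Finset.sum_congr rfl fun i hi => ?_
  have hki : k ∈ s.erase i := Finset.mem_erase.2 ⟨(Finset.ne_of_mem_erase hi).symm, hk⟩
  rw [Function.update_of_ne (Finset.ne_of_mem_erase hi), ← Finset.mul_prod_erase _ _ hki,
    Finset.erase_right_comm]
  ring

end Interlacing

section RankOne

variable {ι K : Type*} [Fintype ι] [DecidableEq ι] [Field K]

theorem det_diagonal_add_vecMulVec {d : ι → K} (hd : ∀ i, d i ≠ 0) (u v : ι → K) :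
    (diagonal d + vecMulVec u v).det =
      ∏ i, d i + ∑ i, u i * v i * ∏ j ∈ Finset.univ.erase i, d j := by
  have hdet : IsUnit (diagonal d).det := by
    rw [det_diagonal, isUnit_iff_ne_zero]
    exact Finset.prod_ne_zero_iff.2 fun i _ => hd i
  rw [vecMulVec_eq Unit, det_add_replicateCol_mul_replicateRow hdet, det_diagonal]
  rw [det_unique, Matrix.add_apply, one_apply_eq, mul_add, mul_one]
  have hinv : (diagonal d)⁻¹ = diagonal d⁻¹ := by
    refine inv_eq_right_inv ?_
    rw [diagonal_mul_diagonal, ← diagonal_one]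
    exact congrArg _ (funext fun i => mul_inv_cancel₀ (hd i))
  rw [hinv, mul_apply]
  simp only [mul_diagonal, replicateRow_apply, replicateCol_apply, Finset.mul_sum, Pi.inv_apply]
  congr 1
  refine Finset.sum_congr rfl fun i hi => ?_
  rw [← Finset.mul_prod_erase _ _ hi]
  field_simp [hd i]

theorem charpoly_diagonal_add_vecMulVec [Infinite K] (a u v : ι → K) :
    (diagonal a + vecMulVec u v).charpoly =
      ∏ i, (X - C (a i)) - ∑ i, C (u i * v i) * ∏ j ∈ Finset.univ.erase i, (X - C (a j)) := by
  refine eq_of_infinite_eval_eq _ _ (((Set.finite_range a).infinite_compl).mono fun x hx => ?_)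
  have hx' : ∀ i, x - a i ≠ 0 := fun i h => hx ⟨i, (sub_eq_zero.1 h).symm⟩
  have hmat : scalar ι x - (diagonal a + vecMulVec u v) =
      diagonal (fun i => x - a i) + vecMulVec (-u) v := by
    rw [neg_vecMulVec, ← sub_sub, scalar_apply, diagonal_sub, sub_eq_add_neg]
  rw [Set.mem_ofPred_eq, eval_charpoly, hmat, det_diagonal_add_vecMulVec hx']
  simp [eval_prod, eval_finsetSum, sub_eq_add_neg]

end RankOne

/-- Realizing the roots `b` as the spectrum of a rank one perturbation of `diagonal a`. -/
theorem exists_charpoly_diagonal_add_smul_vecMulVec_star {ι : Type*} [Fintype ι] [DecidableEq ι]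
    (a b : ι → ℝ) {ε : ℝ} (hε : ε * ε = 1) (hab : ∀ i, 0 ≤ ε * (b i - a i))
    (hsign : ∀ i j, i ≠ j → 0 ≤ (a i - b j) / (a i - a j))
    (hrep : ∀ i j, i ≠ j → a i = a j → b i = a i ∨ b j = a j) :
    ∃ z : ι → ℂ,
      (diagonal (fun i => (a i : ℂ)) + (ε : ℂ) • vecMulVec z (star z)).charpoly =
        ∏ i, (X - C (b i : ℂ)) := by
  obtain ⟨c, hc, heq⟩ := exists_nonneg_prod_X_sub_C_eq Finset.univ a b hε
    (fun i _ => hab i) (fun i _ j _ => hsign i j) (fun i _ j _ => hrep i j)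
  refine ⟨fun i => (√(c i) : ℝ), ?_⟩
  rw [← smul_vecMulVec, charpoly_diagonal_add_vecMulVec]
  have hmap := congrArg (Polynomial.map Complex.ofRealHom) heq
  simp only [Polynomial.map_prod, Polynomial.map_sub, Polynomial.map_sum, Polynomial.map_mul,
    map_X, map_C, Complex.ofRealHom_eq_coe] at hmap
  rw [hmap]
  congr 1
  refine Finset.sum_congr rfl fun i _ => ?_
  congr 2
  simp only [Pi.smul_apply, Pi.star_apply, smul_eq_mul, RCLike.star_def, Complex.conj_ofReal]
  rw [mul_assoc, ← Complex.ofReal_mul, Real.mul_self_sqrt (hc i), Complex.ofReal_mul]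

theorem stmt5 (n : ℕ) (hn : 1 ≤ n) (lam β : ℕ → ℤ)
    (hlam : ∀ i, i + 1 < n → lam (i + 1) ≤ lam i)
    (hβ : ∀ i, i + 1 < n → β (i + 1) ≤ β i) :
    ((∀ i < n, lam i ≤ β i) ∧ (∀ i, i + 1 < n → β (i + 1) ≤ lam i) →
      ∃ z : Fin n → ℂ,
        (Matrix.diagonal (fun i : Fin n => (lam (i : ℕ) : ℂ))
            + Matrix.vecMulVec z (star z)).charpoly
          = ∏ i ∈ Finset.range n, (Polynomial.X - Polynomial.C ((β i : ℤ) : ℂ))) ∧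
    ((∀ i < n, β i ≤ lam i) ∧ (∀ i, i + 1 < n → lam (i + 1) ≤ β i) →
      ∃ z : Fin n → ℂ,
        (Matrix.diagonal (fun i : Fin n => (lam (i : ℕ) : ℂ))
            - Matrix.vecMulVec z (star z)).charpoly
          = ∏ i ∈ Finset.range n, (Polynomial.X - Polynomial.C ((β i : ℤ) : ℂ))) := by
  have hmono : ∀ f : ℕ → ℤ, (∀ i, i + 1 < n → f (i + 1) ≤ f i) →
      ∀ i j, i ≤ j → j < n → f j ≤ f i := by
    intro f hf i j hij
    induction j, hij using Nat.le_induction with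
    | base => exact fun _ => le_rfl
    | succ j _ ih => exact fun hj => (hf j hj).trans (ih (by omega))
  constructor
  · rintro ⟨h₁, h₂⟩
    have hlt : ∀ i j, i < j → j < n → β j ≤ lam i := fun i j hij hj =>
      (hmono β hβ (i + 1) j hij hj).trans (h₂ i (by omega))
    obtain ⟨z, hz⟩ := exists_charpoly_diagonal_add_smul_vecMulVec_star
      (fun i : Fin n => (lam i : ℝ)) (fun i : Fin n => (β i : ℝ)) (ε := 1) (by norm_num)
      (fun i => by have := h₁ i i.2; rify at this; linarith)
      (fun i j hij => by
        have hi := h₁ i i.2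
        have hj := h₁ j j.2
        rcases lt_or_gt_of_ne hij with h | h
        · have := hlt i j h j.2
          rify at *
          exact div_nonneg (by linarith) (by linarith)
        · have := hlt j i h i.2
          rify at *
          exact div_nonneg_of_nonpos (by linarith) (by linarith))
      (fun i j hij heq => by
        have hi := h₁ i i.2
        have hj := h₁ j j.2
        norm_cast at heq ⊢
        rcases lt_or_gt_of_ne hij with h | h
        · have := hlt i j h j.2
          omega
        · have := hlt j i h i.2
          omega)
    refine ⟨z, ?_⟩
    rw [Finset.prod_range]
    simpa using hz
  · rintro ⟨h₁, h₂⟩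
    have hlt : ∀ i j, i < j → j < n → lam j ≤ β i := fun i j hij hj =>
      (hmono lam hlam (i + 1) j hij hj).trans (h₂ i (by omega))
    obtain ⟨z, hz⟩ := exists_charpoly_diagonal_add_smul_vecMulVec_star
      (fun i : Fin n => (lam i : ℝ)) (fun i : Fin n => (β i : ℝ)) (ε := -1) (by norm_num)
      (fun i => by have := h₁ i i.2; rify at this; linarith)
      (fun i j hij => by
        have hi := h₁ i i.2
        have hj := h₁ j j.2
        rcases lt_or_gt_of_ne hij with h | h
        · have := hlt i j h j.2
          rify at *
          exact div_nonneg (by linarith) (by linarith)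
        · have := hlt j i h i.2
          rify at *
          exact div_nonneg_of_nonpos (by linarith) (by linarith))
      (fun i j hij heq => by
        have hi := h₁ i i.2
        have hj := h₁ j j.2
        norm_cast at heq ⊢
        rcases lt_or_gt_of_ne hij with h | h
        · have := hlt i j h j.2
          omega
        · have := hlt j i h i.2
          omega)
    refine ⟨z, ?_⟩
    rw [Finset.prod_range]
    simpa [sub_eq_add_neg] using hz
end

section
/- Let n ≥ 1, let λ ∈ P_n and α ∈ ℝ with α ≠ 0, and let (λ^k)_{k∈ℕ} be a sequence in P_n and (α_k)_{k∈ℕ} a sequence in ℝ∖{0}. Then the following are equivalent: (a) there exist sequences A_k ∈ U(n) and z_k ∈ ℂ^n such that ( A_k (J_{λ^k} + (iα_k/2)·z_k z_k*) A_k*, α_k·A_k z_k, α_k ) converges to (J_λ, 0, α) in M_n(ℂ) × ℂ^n × ℝ; (b) lim_{k→∞} α_k = α and λ^k = λ for all sufficiently large k. (This expresses that the coadjoint orbits O_{(λ^k,α_k)} of U(n)⋉H_n converge to the orbit O_{(λ,α)}.) -/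
open Matrix Filter

/-- `J_λ = diag(iλ₁,…,iλₙ)` for `λ ∈ ℝ^n` (here with integer entries, indexed `0,…,n-1`). -/
noncomputable def Jlam (n : ℕ) (lam : ℕ → ℤ) : Matrix (Fin n) (Fin n) ℂ :=
  Matrix.diagonal fun i => Complex.I * (lam (i : ℕ) : ℂ)

theorem eq_of_antitone_of_prod_sub_eq {n : ℕ} {f g : Fin n → ℤ} (hf : Antitone f)
    (hg : Antitone g)
    (h : ∀ j : Fin (n + 1), ∏ i, (((j : ℕ) : ℤ) - f i) = ∏ i, (((j : ℕ) : ℤ) - g i)) :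
    f = g := by
  have hpoly : ∏ i, (Polynomial.X - Polynomial.C (f i)) =
      ∏ i, (Polynomial.X - Polynomial.C (g i)) := by
    refine Polynomial.eq_of_natDegree_lt_card_of_eval_eq _ _
      (f := fun j : Fin (n + 1) => ((j : ℕ) : ℤ)) (fun a b hab => ?_) (fun j => ?_) ?_
    · exact Fin.ext (Int.ofNat_inj.mp hab)
    · simpa [Polynomial.eval_prod] using h j
    · rw [Polynomial.natDegree_finsetProd_X_sub_C_eq_card,
        Polynomial.natDegree_finsetProd_X_sub_C_eq_card]
      simp
  have hroots : ∀ u : Fin n → ℤ, (∏ i, (Polynomial.X - Polynomial.C (u i))).roots =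
      (List.ofFn u : Multiset ℤ) := fun u => by
    have := Polynomial.roots_multiset_prod_X_sub_C (Finset.univ.val.map u)
    rw [Multiset.map_map] at this
    rw [← Fin.univ_val_map]
    exact this
  have hperm : (List.ofFn f).Perm (List.ofFn g) := by
    rw [← Multiset.coe_eq_coe, ← hroots, ← hroots, hpoly]
  exact List.ofFn_injective (hperm.eq_of_sortedGE hf.sortedGE_ofFn hg.sortedGE_ofFn)

theorem antitone_fin_of_succ_le {n : ℕ} {u : ℕ → ℤ} (hu : ∀ i, i + 1 < n → u (i + 1) ≤ u i) :
    Antitone fun i : Fin n => u i := by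
  rintro ⟨a, ha⟩ ⟨b, hb⟩ (hab : a ≤ b)
  change u b ≤ u a
  induction b, hab using Nat.le_induction with
  | base => exact le_rfl
  | succ b _ ih => exact (hu b hb).trans (ih (by omega))

theorem det_smul_one_add_conj_Jlam {n : ℕ} {A : Matrix (Fin n) (Fin n) ℂ}
    (hA : A ∈ Matrix.unitaryGroup (Fin n) ℂ) (u : ℕ → ℤ) (m : ℤ) :
    ((m : ℂ) • (1 : Matrix (Fin n) (Fin n) ℂ) + Complex.I • (A * Jlam n u * Aᴴ)).det =
      ((∏ i : Fin n, (m - u i) : ℤ) : ℂ) := by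
  have hA' : A * Aᴴ = 1 := Matrix.mem_unitaryGroup_iff.mp hA
  have hdiag : (m : ℂ) • (1 : Matrix (Fin n) (Fin n) ℂ) + Complex.I • Jlam n u =
      Matrix.diagonal fun i : Fin n => (m : ℂ) - u i := by
    rw [Jlam, Matrix.smul_one_eq_diagonal, ← Matrix.diagonal_smul, Matrix.diagonal_add]
    congr 1
    funext i
    simp [← mul_assoc, sub_eq_add_neg]
  have hconj : (m : ℂ) • (1 : Matrix (Fin n) (Fin n) ℂ) + Complex.I • (A * Jlam n u * Aᴴ) =
      A * ((m : ℂ) • (1 : Matrix (Fin n) (Fin n) ℂ) + Complex.I • Jlam n u) * Aᴴ := by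
    simp [Matrix.mul_add, Matrix.add_mul, hA']
  rw [hconj, Matrix.det_mul_right_comm, hA', one_mul, hdiag, Matrix.det_diagonal]
  push_cast
  rfl

theorem conj_vecMulVec_star {n : ℕ} (A : Matrix (Fin n) (Fin n) ℂ) (z : Fin n → ℂ) :
    A * Matrix.vecMulVec z (star z) * Aᴴ =
      Matrix.vecMulVec (A.mulVec z) (star (A.mulVec z)) := by
  rw [Matrix.mul_vecMulVec, Matrix.vecMulVec_mul, Matrix.star_mulVec]

theorem eventually_eq_of_tendsto_conj_Jlam {n : ℕ} {lam : ℕ → ℤ}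
    (hlam : ∀ i, i + 1 < n → lam (i + 1) ≤ lam i) {lamk : ℕ → ℕ → ℤ}
    (hlamk : ∀ k i, i + 1 < n → lamk k (i + 1) ≤ lamk k i)
    {A : ℕ → Matrix (Fin n) (Fin n) ℂ} (hA : ∀ k, A k ∈ Matrix.unitaryGroup (Fin n) ℂ)
    (h : Tendsto (fun k => A k * Jlam n (lamk k) * (A k)ᴴ) atTop (nhds (Jlam n lam))) :
    ∀ᶠ k in atTop, ∀ i < n, lamk k i = lam i := by
  have hprod : ∀ j : Fin (n + 1), ∀ᶠ k in atTop,
      ∏ i : Fin n, (((j : ℕ) : ℤ) - lamk k i) = ∏ i : Fin n, (((j : ℕ) : ℤ) - lam i) := by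
    intro j
    have hcont : Continuous fun M : Matrix (Fin n) (Fin n) ℂ =>
        ((((j : ℕ) : ℤ) : ℂ) • (1 : Matrix (Fin n) (Fin n) ℂ) + Complex.I • M).det := by
      fun_prop
    have hlim := (hcont.tendsto _).comp h
    have hone := det_smul_one_add_conj_Jlam (one_mem (Matrix.unitaryGroup (Fin n) ℂ)) lam
      ((j : ℕ) : ℤ)
    rw [Matrix.conjTranspose_one, mul_one, one_mul] at hone
    rw [hone] at hlim
    simp only [Function.comp_def, det_smul_one_add_conj_Jlam (hA _)] at hlim
    have := Complex.isClosedEmbedding_intCast.tendsto_nhds_iff.mpr hlim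
    rw [nhds_discrete] at this
    exact tendsto_pure.mp this
  filter_upwards [eventually_all.mpr hprod] with k hk i hi
  exact congrFun (eq_of_antitone_of_prod_sub_eq (antitone_fin_of_succ_le (hlamk k))
    (antitone_fin_of_succ_le hlam) hk) ⟨i, hi⟩

theorem stmt6 (n : ℕ) (hn : 1 ≤ n) (lam : ℕ → ℤ)
    (hlam : ∀ i, i + 1 < n → lam (i + 1) ≤ lam i)
    (α : ℝ) (hα : α ≠ 0)
    (lamk : ℕ → ℕ → ℤ) (hlamk : ∀ k i, i + 1 < n → lamk k (i + 1) ≤ lamk k i)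
    (αk : ℕ → ℝ) (hαk : ∀ k, αk k ≠ 0) :
    (∃ (A : ℕ → Matrix (Fin n) (Fin n) ℂ) (z : ℕ → Fin n → ℂ),
        (∀ k, A k ∈ Matrix.unitaryGroup (Fin n) ℂ) ∧
        Tendsto (fun k =>
            ((A k) * (Jlam n (lamk k)
                  + (Complex.I * (αk k : ℂ) / 2) • Matrix.vecMulVec (z k) (star (z k)))
                * (A k)ᴴ,
              ((αk k : ℝ) : ℂ) • (A k).mulVec (z k),
              αk k))
          atTop
          (nhds (Jlam n lam, (0 : Fin n → ℂ), α)))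
      ↔ (Tendsto αk atTop (nhds α) ∧ ∀ᶠ k in atTop, ∀ i < n, lamk k i = lam i) := by
  constructor
  · rintro ⟨A, z, hA, h⟩
    rw [nhds_prod_eq, nhds_prod_eq] at h
    have hM := h.fst
    have hv := h.snd.fst
    have ha : Tendsto αk atTop (nhds α) := h.snd.snd
    refine ⟨ha, eventually_eq_of_tendsto_conj_Jlam hlam hlamk hA ?_⟩
    have haC : Tendsto (fun k => (αk k : ℂ)) atTop (nhds (α : ℂ)) :=
      (Complex.continuous_ofReal.tendsto α).comp ha
    have hw : Tendsto (fun k => (A k).mulVec (z k)) atTop (nhds 0) := by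
      have := (haC.inv₀ (by exact_mod_cast hα)).smul hv
      rw [smul_zero] at this
      refine this.congr fun k => ?_
      exact inv_smul_smul₀ (by exact_mod_cast hαk k) _
    have hrank : Tendsto (fun k => (Complex.I * (αk k : ℂ) / 2) •
        Matrix.vecMulVec ((A k).mulVec (z k)) (star ((A k).mulVec (z k)))) atTop (nhds 0) := by
      have hcont : Continuous fun w : Fin n → ℂ => Matrix.vecMulVec w (star w) := by
        fun_prop
      have hvec := (hcont.tendsto 0).comp hw
      simpa using ((haC.const_mul Complex.I).div_const 2).smul hvec
    have hsub := hM.sub hrank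
    rw [sub_zero] at hsub
    refine hsub.congr fun k => ?_
    rw [← conj_vecMulVec_star]
    simp [Matrix.mul_add, Matrix.add_mul]
  · rintro ⟨ha, hev⟩
    refine ⟨fun _ => 1, fun _ => 0, fun _ => one_mem _, ?_⟩
    refine Tendsto.prodMk_nhds (tendsto_const_nhds.congr' ?_)
      (Tendsto.prodMk_nhds (by simp) ha)
    filter_upwards [hev] with k hk
    have : Jlam n (lamk k) = Jlam n lam := by
      simp [Jlam, hk]
    simp [this]
end

section
/- Let n ≥ 1, let λ ∈ P_n, and let (μ^k)_{k∈ℕ} be a sequence in P_{n−1} and (r_k)_{k∈ℕ} a sequence of positive reals. Then the following are equivalent: (a) there exist sequences A_k ∈ U(n) and B_k ∈ W such that ( A_k (J_{μ^k} + B_k) A_k*, A_k v_{r_k}, 0 ) converges to (J_λ, 0, 0) in M_n(ℂ) × ℂ^n × ℝ; (b) lim_{k→∞} r_k = 0 and, for all sufficiently large k, λ₁ ≥ μ^k₁ ≥ λ₂ ≥ μ^k₂ ≥ … ≥ λ_{n−1} ≥ μ^k_{n−1} ≥ λₙ. (This expresses that the coadjoint orbits O_{(μ^k,r_k)} of U(n)⋉H_n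 converge to the orbit O_λ.) -/
open Matrix Filter

/-- `J_μ = diag(iμ₁,…,iμ_{n-1},0)` for `μ ∈ ℤ^{n-1}` (indexed `0,…,n-2`). -/
noncomputable def Jmu (n : ℕ) (μ : ℕ → ℤ) : Matrix (Fin n) (Fin n) ℂ :=
  Matrix.diagonal fun i => if (i : ℕ) < n - 1 then Complex.I * (μ (i : ℕ) : ℂ) else 0

/-- `v_r = (0,…,0,r)ᵀ ∈ ℂ^n`. -/
noncomputable def vr (n : ℕ) (r : ℝ) : Fin n → ℂ := fun i =>
  if (i : ℕ) = n - 1 then (r : ℂ) else 0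

open Finset in
/-- Partial fractions of `∏ (x - a i) / ∏ (x - b i)` for interlacing sequences. -/
theorem exists_partialFractions_of_interlacing (m : ℕ) : ∀ (a b : ℕ → ℝ),
    (∀ j < m, b j ≤ a j ∧ a (j + 1) ≤ b j) →
    ∃ (c : ℝ) (w : ℕ → ℝ), (∀ i, 0 ≤ w i) ∧ ∀ x : ℝ, (∀ i < m, x ≠ b i) →
      ∏ i ∈ range (m + 1), (x - a i) =
        (∏ i ∈ range m, (x - b i)) * (x - c - ∑ i ∈ range m, w i / (x - b i)) := by
  induction m with
  | zero => exact fun a b _ => ⟨a 0, 0, by simp, by simp⟩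
  | succ m ih =>
    intro a b h
    have hm := h m (by omega)
    rcases eq_or_lt_of_le hm.1 with heq | hlt
    · obtain ⟨c, w, hw, hx⟩ := ih (Function.update a m (a (m + 1))) b (by
        intro j hj
        have h1 := h j (by omega)
        rw [Function.update_of_ne (by omega)]
        refine ⟨h1.1, ?_⟩
        by_cases hj' : j + 1 = m
        · subst hj'
          rw [Function.update_self]
          linarith
        · rw [Function.update_of_ne hj']
          exact h1.2)
      refine ⟨c, Function.update w m 0, fun i => ?_, fun x hxb => ?_⟩
      · by_cases hi : i = m
        · simp [hi]
        · simpa [hi] using hw i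
      · have h1 := hx x fun i hi => hxb i (by omega)
        have h2 : ∏ i ∈ range m, (x - Function.update a m (a (m + 1)) i) =
            ∏ i ∈ range m, (x - a i) := prod_congr rfl fun i hi => by
          rw [Function.update_of_ne (by have := mem_range.1 hi; omega)]
        have h3 : ∑ i ∈ range m, Function.update w m 0 i / (x - b i) =
            ∑ i ∈ range m, w i / (x - b i) := sum_congr rfl fun i hi => by
          rw [Function.update_of_ne (by have := mem_range.1 hi; omega)]
        rw [prod_range_succ, Function.update_self, h2] at h1
        rw [prod_range_succ, prod_range_succ, prod_range_succ _ m, sum_range_succ, h3,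
          Function.update_self, ← heq]
        linear_combination (x - b m) * h1
    · obtain ⟨c, w, hw, hx⟩ := ih a b fun j hj => h j (by omega)
      have ha : ∀ j ≤ m, a m ≤ a j := fun j hj => by
        induction hj using Nat.decreasingInduction with
        | self => rfl
        | of_succ k hk ihk => have := h k (by omega); linarith
      have hb : ∀ i < m, b m < b i := fun i hi => by
        have := ha (i + 1) hi
        have := h i (by omega)
        linarith
      set d := b m - a (m + 1) with hd
      have hd0 : 0 ≤ d := sub_nonneg.2 hm.2
      have hval := hx (b m) fun i hi => (hb i hi).ne
      set f := b m - c - ∑ i ∈ range m, w i / (b m - b i) with hf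
      have hf0 : f ≤ 0 := by
        have hneg : ∀ (k : ℕ) (g : ℕ → ℝ), ∏ i ∈ range k, (b m - g i) =
            (-1) ^ k * ∏ i ∈ range k, (g i - b m) := fun k g => by
          simpa using prod_neg (s := range k) (fun i => g i - b m)
        have p1 : 0 ≤ ∏ i ∈ range (m + 1), (a i - b m) := prod_nonneg fun i hi => by
          have := ha i (by have := mem_range.1 hi; omega)
          linarith
        have p2 : 0 < ∏ i ∈ range m, (b i - b m) := prod_pos fun i hi =>
          sub_pos.2 (hb i (mem_range.1 hi))
        rw [hneg, hneg, pow_succ] at hval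
        have hs : ((-1 : ℝ) ^ m) ≠ 0 := by positivity
        have : (∏ i ∈ range m, (b i - b m)) * f = -∏ i ∈ range (m + 1), (a i - b m) := by
          apply mul_left_cancel₀ hs
          linear_combination -hval
        by_contra! hpos
        nlinarith [mul_pos p2 hpos]
      refine ⟨c - d, fun i => if i < m then w i * (1 + d / (b i - b m)) else -(d * f),
        fun i => ?_, fun x hxb => ?_⟩
      · dsimp only
        split_ifs with hi
        · have := sub_pos.2 (hb i hi)
          have := hw i
          positivity
        · nlinarith
      · have h1 := hx x fun i hi => hxb i (by omega)
        have hxm : x - b m ≠ 0 := sub_ne_zero.2 (hxb m (by omega))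
        have h2 : ∑ i ∈ range m, (if i < m then w i * (1 + d / (b i - b m)) else -(d * f))
              / (x - b i) =
            (∑ i ∈ range m, w i / (x - b i)) * (1 + d / (x - b m)) -
              (∑ i ∈ range m, w i / (b m - b i)) * (d / (x - b m)) := by
          rw [sum_mul, sum_mul, ← sum_sub_distrib]
          refine sum_congr rfl fun i hi => ?_
          have hi' := mem_range.1 hi
          have n1 : x - b i ≠ 0 := sub_ne_zero.2 (hxb i (by omega))
          have n2 : b i - b m ≠ 0 := (sub_pos.2 (hb i hi')).ne'
          have n3 : b m - b i ≠ 0 := (sub_neg.2 (hb i hi')).ne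
          rw [if_pos hi', ← neg_sub (b i) (b m)]
          field_simp
          ring
        have h3 : x - a (m + 1) = (x - b m) * (1 + d / (x - b m)) := by
          field_simp
          rw [hd]
          ring
        rw [prod_range_succ, h1, prod_range_succ _ m, sum_range_succ]
        dsimp only
        rw [h2, if_neg (lt_irrefl m), h3, mul_assoc, mul_assoc]
        congr 1
        rw [hf]
        field_simp
        ring

theorem Matrix.sum_norm_sq_mulVec_of_mem_unitaryGroup {n : Type*} [Fintype n] [DecidableEq n]
    {A : Matrix n n ℂ} (hA : A ∈ unitaryGroup n ℂ) (x : n → ℂ) :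
    ∑ i, ‖(A *ᵥ x) i‖ ^ 2 = ∑ i, ‖x i‖ ^ 2 := by
  have key (y : n → ℂ) : star y ⬝ᵥ y = ((∑ i, ‖y i‖ ^ 2 : ℝ) : ℂ) := by
    simp [dotProduct, ← Complex.conj_mul']
  have h : star (A *ᵥ x) ⬝ᵥ (A *ᵥ x) = star x ⬝ᵥ x := by
    rw [star_mulVec, dotProduct_mulVec, vecMul_vecMul, ← star_eq_conjTranspose,
      mem_unitaryGroup_iff'.1 hA, vecMul_one]
  rw [key, key] at h
  exact_mod_cast h

theorem Matrix.exists_ne_zero_vanishing_on {n : Type*} [Fintype n] [DecidableEq n]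
    (A : Matrix n n ℂ) (S T : Finset n) (h : S.card + T.card < Fintype.card n) :
    ∃ x : n → ℂ, x ≠ 0 ∧ (∀ i ∈ S, x i = 0) ∧ ∀ i ∈ T, (A *ᵥ x) i = 0 := by
  let f : (n → ℂ) →ₗ[ℂ] (S → ℂ) × (T → ℂ) :=
    (LinearMap.funLeft ℂ ℂ (Subtype.val : S → n)).prod
      ((LinearMap.funLeft ℂ ℂ (Subtype.val : T → n)).comp (mulVecLin A))
  have hf : LinearMap.ker f ≠ ⊥ := f.ker_ne_bot_of_finrank_lt (by simpa using h)
  obtain ⟨x, hx, hx0⟩ := (Submodule.ne_bot_iff _).1 hf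
  have hx' := Prod.ext_iff.1 (LinearMap.mem_ker.1 hx)
  exact ⟨x, hx0, fun i hi => congrFun hx'.1 ⟨i, hi⟩, fun i hi => congrFun hx'.2 ⟨i, hi⟩⟩

theorem Matrix.norm_star_dotProduct_mulVec_le {n : Type*} [Fintype n] {E : Matrix n n ℂ} {δ : ℝ}
    (hE : ∀ i j, ‖E i j‖ ≤ δ) (hδ : 0 ≤ δ) (x : n → ℂ) :
    ‖star x ⬝ᵥ (E *ᵥ x)‖ ≤ δ * Fintype.card n * ∑ i, ‖x i‖ ^ 2 := by
  calc ‖star x ⬝ᵥ (E *ᵥ x)‖ ≤ ∑ i, ∑ j, ‖x i‖ * (δ * ‖x j‖) := by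
        refine (norm_sum_le _ _).trans (Finset.sum_le_sum fun i _ => ?_)
        rw [norm_mul, ← Finset.mul_sum, Pi.star_apply, norm_star]
        refine mul_le_mul_of_nonneg_left ((norm_sum_le _ _).trans
          (Finset.sum_le_sum fun j _ => ?_)) (norm_nonneg _)
        rw [norm_mul]
        exact mul_le_mul_of_nonneg_right (hE i j) (norm_nonneg _)
    _ = δ * (∑ i, ‖x i‖) ^ 2 := by
        simp_rw [pow_two, Finset.sum_mul_sum, Finset.mul_sum]
        exact Finset.sum_congr rfl fun i _ => Finset.sum_congr rfl fun j _ => by ring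
    _ ≤ δ * (Fintype.card n * ∑ i, ‖x i‖ ^ 2) :=
        mul_le_mul_of_nonneg_left sq_sum_le_card_mul_sum_sq hδ
    _ = _ := by ring

theorem star_dotProduct_diagonal_mulVec {n : Type*} [Fintype n] [DecidableEq n] (d : n → ℝ)
    (x : n → ℂ) :
    star x ⬝ᵥ (diagonal (fun i => Complex.I * (d i : ℂ)) *ᵥ x) =
      Complex.I * ((∑ i, d i * ‖x i‖ ^ 2 : ℝ) : ℂ) := by
  simp only [dotProduct, mulVec_diagonal, Pi.star_apply, RCLike.star_def]
  push_cast
  rw [Finset.mul_sum]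
  refine Finset.sum_congr rfl fun i _ => ?_
  rw [← Complex.conj_mul']
  ring

/-- If a unitary conjugate of `K` is entrywise close to `diag(i d)` and `K` agrees with `diag(i e)`
away from the rows and columns in `T`, the diagonal forms nearly agree at some nonzero vector
satisfying fewer than `n` prescribed vanishing conditions. -/
theorem exists_quadratic_form_close {n : Type*} [Fintype n] [DecidableEq n]
    {A K : Matrix n n ℂ} (hA : A ∈ unitaryGroup n ℂ) {d e : n → ℝ} {δ : ℝ} (hδ : 0 ≤ δ)
    (hclose : ∀ i j, ‖(A * K * Aᴴ - diagonal fun i => Complex.I * (d i : ℂ)) i j‖ ≤ δ)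
    (S T : Finset n) (hST : S.card + T.card < Fintype.card n)
    (hK : ∀ i ∉ T, ∀ j ∉ T, K i j = diagonal (fun i => Complex.I * (e i : ℂ)) i j) :
    ∃ x y : n → ℂ, 0 < ∑ i, ‖x i‖ ^ 2 ∧ (∀ i ∈ S, x i = 0) ∧ (∀ i ∈ T, y i = 0) ∧
      ∑ i, ‖y i‖ ^ 2 = ∑ i, ‖x i‖ ^ 2 ∧
      |∑ i, e i * ‖y i‖ ^ 2 - ∑ i, d i * ‖x i‖ ^ 2| ≤
        δ * Fintype.card n * ∑ i, ‖x i‖ ^ 2 := by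
  obtain ⟨x, hx0, hxS, hxT⟩ := exists_ne_zero_vanishing_on Aᴴ S T hST
  have hA' : Aᴴ ∈ unitaryGroup n ℂ := Unitary.star_mem hA
  refine ⟨x, Aᴴ *ᵥ x, ?_, hxS, hxT, sum_norm_sq_mulVec_of_mem_unitaryGroup hA' x, ?_⟩
  · obtain ⟨i, hi⟩ := Function.ne_iff.1 hx0
    exact Finset.sum_pos' (fun i _ => by positivity)
      ⟨i, Finset.mem_univ i, by have := norm_pos_iff.2 hi; positivity⟩
  · have h := norm_star_dotProduct_mulVec_le hclose hδ x
    have hform : star x ⬝ᵥ ((A * K * Aᴴ) *ᵥ x) =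
        star (Aᴴ *ᵥ x) ⬝ᵥ (diagonal (fun i => Complex.I * (e i : ℂ)) *ᵥ (Aᴴ *ᵥ x)) := by
      rw [← mulVec_mulVec, ← mulVec_mulVec, dotProduct_mulVec, ← conjTranspose_conjTranspose A,
        ← star_mulVec, conjTranspose_conjTranspose]
      generalize Aᴴ *ᵥ x = y at hxT
      simp only [dotProduct, mulVec, Finset.mul_sum]
      refine Finset.sum_congr rfl fun i _ => Finset.sum_congr rfl fun j _ => ?_
      by_cases hi : i ∈ T
      · simp [hxT i hi]
      by_cases hj : j ∈ T
      · simp [hxT j hj]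
      rw [hK i hi j hj]
    rwa [sub_mulVec, dotProduct_sub, hform, star_dotProduct_diagonal_mulVec,
      star_dotProduct_diagonal_mulVec, ← mul_sub, norm_mul, Complex.norm_I, one_mul,
      ← Complex.ofReal_sub, Complex.norm_real, Real.norm_eq_abs] at h

theorem exists_equiv_eq_comp_of_map_univ_eq {α β : Type*} [Fintype α] [DecidableEq β]
    {f g : α → β} (h : Multiset.map f Finset.univ.val = Multiset.map g Finset.univ.val) :
    ∃ σ : α ≃ α, f = g ∘ σ := by
  have hcard (b : β) : Fintype.card {a // f a = b} = Fintype.card {a // g a = b} := by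
    have hb := congrArg (Multiset.count b) h
    simp only [Multiset.count_map, ← Finset.filter_val, Finset.card_val] at hb
    simpa [Fintype.card_subtype, eq_comm] using hb
  let e (b : β) := Fintype.equivOfCardEq (hcard b)
  refine ⟨(Equiv.sigmaFiberEquiv f).symm.trans
    ((Equiv.sigmaCongrRight e).trans (Equiv.sigmaFiberEquiv g)), funext fun a => ?_⟩
  exact (e (f a) ⟨a, rfl⟩).2.symm

theorem Matrix.IsHermitian.exists_unitary_conj_eq_diagonal {n : Type*} [Fintype n] [DecidableEq n]
    {H : Matrix n n ℂ} (hH : H.IsHermitian) (l : n → ℝ)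
    (hl : H.charpoly = ∏ i, (Polynomial.X - Polynomial.C (l i : ℂ))) :
    ∃ A ∈ unitaryGroup n ℂ, A * H * Aᴴ = diagonal fun i => (l i : ℂ) := by
  have hroots := hH.roots_charpoly_eq_eigenvalues
  rw [hl, Polynomial.roots_prod _ _ (Finset.prod_ne_zero_iff.2 fun i _ =>
    Polynomial.X_sub_C_ne_zero _)] at hroots
  have hms : Multiset.map l Finset.univ.val = Multiset.map hH.eigenvalues Finset.univ.val := by
    apply Multiset.map_injective Complex.ofReal_injective
    simpa [Function.comp_def] using hroots
  obtain ⟨σ, hσ⟩ : ∃ σ : n ≃ n, l = hH.eigenvalues ∘ σ :=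
    exists_equiv_eq_comp_of_map_univ_eq hms
  set U := (hH.eigenvectorUnitary : Matrix n n ℂ)
  have hU : U ∈ unitaryGroup n ℂ := hH.eigenvectorUnitary.2
  have hUU : Uᴴ * U = 1 := mem_unitaryGroup_iff'.1 hU
  refine ⟨Uᴴ.submatrix σ id, ?_, ?_⟩
  · rw [mem_unitaryGroup_iff, star_eq_conjTranspose, conjTranspose_submatrix,
      conjTranspose_conjTranspose, ← submatrix_mul _ _ _ _ _ Function.bijective_id, hUU]
    simp
  · have hspec : Uᴴ * H * U = diagonal (fun i => (hH.eigenvalues i : ℂ)) := by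
      have := hH.conjStarAlgAut_star_eigenvectorUnitary
      simp only [Unitary.conjStarAlgAut_apply, Unitary.coe_star, star_star] at this
      exact this
    rw [conjTranspose_submatrix, conjTranspose_conjTranspose]
    have e : Uᴴ.submatrix σ id * H * U.submatrix id σ = (Uᴴ * H * U).submatrix σ σ := by
      ext i j
      simp [Matrix.mul_apply]
    rw [e, hspec, submatrix_diagonal_equiv, hσ]
    rfl

theorem Matrix.eval_charpoly_fromBlocks_diagonal {m : Type*} [Fintype m] [DecidableEq m]
    (b v : m → ℂ) (c x : ℂ) (hx : ∀ i, x ≠ b i) :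
    (fromBlocks (diagonal b) (replicateCol (Fin 1) v) (replicateRow (Fin 1) v)
      (diagonal fun _ => c)).charpoly.eval x =
      (∏ i, (x - b i)) * (x - c - ∑ i, v i ^ 2 / (x - b i)) := by
  have hx' (i : m) : x - b i ≠ 0 := sub_ne_zero.2 (hx i)
  have hblock : scalar (m ⊕ Fin 1) x - fromBlocks (diagonal b) (replicateCol (Fin 1) v)
      (replicateRow (Fin 1) v) (diagonal fun _ => c) =
      fromBlocks (diagonal fun i => x - b i) (-replicateCol (Fin 1) v)
        (-replicateRow (Fin 1) v) (diagonal fun _ => x - c) := by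
    ext (i | i) (j | j) <;> simp [diagonal_apply, ite_sub_ite]
  let : Invertible (diagonal fun i => x - b i) := ⟨diagonal fun i => (x - b i)⁻¹,
    by simp [hx'], by simp [hx']⟩
  have hinv : ⅟(diagonal fun i => x - b i) = diagonal fun i => (x - b i)⁻¹ := rfl
  rw [eval_charpoly, hblock, det_fromBlocks₁₁, det_diagonal, hinv, det_unique]
  congr 1
  simp [Matrix.mul_apply, diagonal_apply]
  refine Finset.sum_congr rfl fun i _ => ?_
  ring

/-- Converse of Cauchy interlacing: a bordered diagonal Hermitian matrix with prescribed
interlacing spectrum. -/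
theorem exists_bordered_hermitian_of_interlacing (m : ℕ) (a b : ℕ → ℝ)
    (h : ∀ j < m, b j ≤ a j ∧ a (j + 1) ≤ b j) :
    ∃ H A : Matrix (Fin (m + 1)) (Fin (m + 1)) ℂ, H.IsHermitian ∧
      (∀ i j : Fin (m + 1), (i : ℕ) < m → (j : ℕ) < m → H i j = if i = j then (b i : ℂ) else 0) ∧
      A ∈ unitaryGroup (Fin (m + 1)) ℂ ∧ A * H * Aᴴ = diagonal fun i : Fin (m + 1) => (a i : ℂ) := by
  obtain ⟨c, w, hw, hx⟩ := exists_partialFractions_of_interlacing m a b h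
  let v : Fin m → ℂ := fun i => (Real.sqrt (w i) : ℂ)
  let F := fromBlocks (diagonal fun i : Fin m => (b i : ℂ)) (replicateCol (Fin 1) v)
    (replicateRow (Fin 1) v) (diagonal fun _ => (c : ℂ))
  let H := reindex finSumFinEquiv finSumFinEquiv F
  have hF : F.IsHermitian := by
    ext (i | i) (j | j)
    · by_cases hij : i = j
      · simp [F, hij]
      · simp [F, hij, Ne.symm hij]
    · simp [F, v]
    · simp [F, v]
    · simp [F, Subsingleton.elim i j]
  have hH : H.IsHermitian := by
    simpa [H] using hF.submatrix finSumFinEquiv.symm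
  have hchar : H.charpoly = ∏ i : Fin (m + 1), (Polynomial.X - Polynomial.C ((a i : ℝ) : ℂ)) := by
    apply Polynomial.eq_of_infinite_eval_eq
    have hinf : ((fun x : ℝ => (x : ℂ)) '' (Set.range fun i : Fin m => b i)ᶜ).Infinite :=
      (Set.finite_range _).infinite_compl.image Complex.ofReal_injective.injOn
    refine hinf.mono ?_
    rintro _ ⟨x, hxb, rfl⟩
    have hxb' : ∀ i < m, x ≠ b i := fun i hi e => hxb ⟨⟨i, hi⟩, e.symm⟩
    have hprod := congrArg (fun t : ℝ => (t : ℂ)) (hx x hxb')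
    simp only [Finset.prod_range, Finset.sum_range] at hprod
    push_cast at hprod
    rw [Set.mem_ofPred_eq, charpoly_reindex,
      eval_charpoly_fromBlocks_diagonal (fun i : Fin m => (b i : ℂ)) v c x fun i =>
        Complex.ofReal_injective.ne (hxb' i i.2),
      Polynomial.eval_prod]
    simp only [Polynomial.eval_sub, Polynomial.eval_X, Polynomial.eval_C]
    rw [hprod]
    congr 2
    refine Finset.sum_congr rfl fun i _ => ?_
    rw [← Complex.ofReal_pow, Real.sq_sqrt (hw i)]
  obtain ⟨A, hA, hAH⟩ := hH.exists_unitary_conj_eq_diagonal (fun i => a i) hchar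
  refine ⟨H, A, hH, fun i j hi hj => ?_, hA, hAH⟩
  obtain ⟨i, rfl⟩ : ∃ i' : Fin m, i = Fin.castAdd 1 i' := ⟨⟨i, hi⟩, rfl⟩
  obtain ⟨j, rfl⟩ : ∃ j' : Fin m, j = Fin.castAdd 1 j' := ⟨⟨j, hj⟩, rfl⟩
  simp only [H, F, reindex_apply, submatrix_apply, finSumFinEquiv_symm_apply_castAdd,
    fromBlocks_apply₁₁, diagonal_apply, Fin.val_castAdd, Fin.castAdd_inj]

theorem Jmu_apply_eq_diagonal {n : ℕ} (μ : ℕ → ℤ) (i j : Fin n) (hi : (i : ℕ) < n - 1) :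
    Jmu n μ i j = diagonal (fun i : Fin n => Complex.I * (((μ i : ℤ) : ℝ) : ℂ)) i j := by
  by_cases hij : i = j
  · simp [Jmu, hij, hij ▸ hi]
  · simp [Jmu, hij]

theorem sum_norm_sq_vr {n : ℕ} (hn : 1 ≤ n) (r : ℝ) : ∑ i, ‖vr n r i‖ ^ 2 = r ^ 2 := by
  rw [Finset.sum_eq_single ⟨n - 1, by omega⟩]
  · simp [vr]
  · intro i _ hi
    have : (i : ℕ) ≠ n - 1 := fun h => hi (Fin.ext h)
    simp [vr, this]
  · simp

/-- Approximate Cauchy interlacing, made exact by integrality. -/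
theorem interlacing_of_close {n : ℕ} {lam μ : ℕ → ℤ}
    (hlam : ∀ i, i + 1 < n → lam (i + 1) ≤ lam i)
    (hμ : ∀ i, i + 1 < n - 1 → μ (i + 1) ≤ μ i) {A B : Matrix (Fin n) (Fin n) ℂ}
    (hA : A ∈ unitaryGroup (Fin n) ℂ)
    (hB : ∀ i j : Fin n, (i : ℕ) < n - 1 → (j : ℕ) < n - 1 → B i j = 0)
    {δ : ℝ} (hδ : 0 ≤ δ) (hδn : δ * n < 1)
    (hclose : ∀ i j, ‖(A * (Jmu n μ + B) * Aᴴ - Jlam n lam) i j‖ ≤ δ) :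
    ∀ j < n - 1, μ j ≤ lam j ∧ lam (j + 1) ≤ μ j := by
  have hlam' : ∀ i j, i ≤ j → j < n → lam j ≤ lam i := fun i j hij => by
    induction hij with
    | refl => exact fun _ => le_rfl
    | step _ ih => exact fun hj => (hlam _ hj).trans (ih (by omega))
  have hμ' : ∀ i j, i ≤ j → j < n - 1 → μ j ≤ μ i := fun i j hij => by
    induction hij with
    | refl => exact fun _ => le_rfl
    | step _ ih => exact fun hj => (hμ _ hj).trans (ih (by omega))
  have hclose' : ∀ i j, ‖(A * (Jmu n μ + B) * Aᴴ -
      diagonal fun i : Fin n => Complex.I * (((lam i : ℤ) : ℝ) : ℂ)) i j‖ ≤ δ := by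
    simpa [Jlam] using hclose
  have hK (T : Finset (Fin n)) (hT : ∀ i ∉ T, (i : ℕ) < n - 1) : ∀ i ∉ T, ∀ j ∉ T,
      (Jmu n μ + B) i j = diagonal (fun i : Fin n => Complex.I * (((μ i : ℤ) : ℝ) : ℂ)) i j :=
    fun i hi j hj => by
      rw [Matrix.add_apply, hB i j (hT i hi) (hT j hj), add_zero,
        Jmu_apply_eq_diagonal μ i j (hT i hi)]
  intro j hj
  have hn1 : n - 1 < n := by omega
  have hjn : j < n := by omega
  constructor
  · obtain ⟨x, y, hx, hxS, hyT, hxy, hq⟩ := exists_quadratic_form_close hA hδ hclose'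
      (Finset.Iio ⟨j, hjn⟩) (Finset.Ioi ⟨j, hjn⟩)
      (by simp only [Fin.card_Iio, Fin.card_Ioi, Fintype.card_fin]; omega)
      (hK _ fun i hi => by
        rw [Finset.mem_Ioi, Fin.lt_def] at hi
        simp only at hi
        omega)
    have h1 : (μ j : ℝ) * ∑ i, ‖y i‖ ^ 2 ≤ ∑ i : Fin n, ((μ i : ℤ) : ℝ) * ‖y i‖ ^ 2 := by
      rw [Finset.mul_sum]
      refine Finset.sum_le_sum fun i _ => ?_
      by_cases hi : j < i
      · simp [hyT i (Finset.mem_Ioi.2 (Fin.lt_def.2 hi))]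
      · have : (μ j : ℝ) ≤ μ i := by exact_mod_cast hμ' i j (by omega) hj
        gcongr
    have h2 : ∑ i : Fin n, ((lam i : ℤ) : ℝ) * ‖x i‖ ^ 2 ≤ (lam j : ℝ) * ∑ i, ‖x i‖ ^ 2 := by
      rw [Finset.mul_sum]
      refine Finset.sum_le_sum fun i _ => ?_
      by_cases hi : (i : ℕ) < j
      · simp [hxS i (Finset.mem_Iio.2 (Fin.lt_def.2 hi))]
      · have : (lam i : ℝ) ≤ lam j := by exact_mod_cast hlam' j i (by omega) i.2
        gcongr
    have h3 := (abs_le.1 hq).2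
    rw [Fintype.card_fin] at h3
    have h4 : (μ j : ℝ) < lam j + 1 := by
      refine lt_of_mul_lt_mul_right ?_ hx.le
      rw [hxy] at h1
      linarith [mul_lt_mul_of_pos_right hδn hx]
    exact Int.lt_add_one_iff.1 (by exact_mod_cast h4)
  · obtain ⟨x, y, hx, hxS, hyT, hxy, hq⟩ := exists_quadratic_form_close hA hδ hclose'
      (Finset.Ioi ⟨j + 1, by omega⟩) (insert ⟨n - 1, hn1⟩ (Finset.Iio ⟨j, hjn⟩))
      (by
        have := Finset.card_insert_le (⟨n - 1, hn1⟩ : Fin n) (Finset.Iio ⟨j, hjn⟩)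
        simp only [Fin.card_Iio, Fin.card_Ioi, Fintype.card_fin] at this ⊢
        omega)
      (hK _ fun i hi => by
        rw [Finset.mem_insert, not_or, Fin.ext_iff] at hi
        have : (i : ℕ) ≠ n - 1 := hi.1
        omega)
    have h1 : ∑ i : Fin n, ((μ i : ℤ) : ℝ) * ‖y i‖ ^ 2 ≤ (μ j : ℝ) * ∑ i, ‖y i‖ ^ 2 := by
      rw [Finset.mul_sum]
      refine Finset.sum_le_sum fun i _ => ?_
      by_cases hi : (i : ℕ) < j ∨ (i : ℕ) = n - 1
      · simp [hyT i (by simpa [Fin.lt_def, Fin.ext_iff, or_comm] using hi)]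
      · have : (μ i : ℝ) ≤ μ j := by exact_mod_cast hμ' j i (by omega) (by omega)
        gcongr
    have h2 : (lam (j + 1) : ℝ) * ∑ i, ‖x i‖ ^ 2 ≤ ∑ i : Fin n, ((lam i : ℤ) : ℝ) * ‖x i‖ ^ 2 := by
      rw [Finset.mul_sum]
      refine Finset.sum_le_sum fun i _ => ?_
      by_cases hi : j + 1 < i
      · simp [hxS i (Finset.mem_Ioi.2 (Fin.lt_def.2 hi))]
      · have : (lam (j + 1) : ℝ) ≤ lam i := by
          exact_mod_cast hlam' i (j + 1) (by omega) (by omega)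
        gcongr
    have h3 := (abs_le.1 hq).1
    rw [Fintype.card_fin] at h3
    have h4 : (lam (j + 1) : ℝ) < μ j + 1 := by
      refine lt_of_mul_lt_mul_right ?_ hx.le
      rw [hxy] at h1
      linarith [mul_lt_mul_of_pos_right hδn hx]
    exact Int.lt_add_one_iff.1 (by exact_mod_cast h4)

theorem exists_conj_Jmu_add_eq_Jlam {n : ℕ} (hn : 1 ≤ n) (lam μ : ℕ → ℤ)
    (h : ∀ j < n - 1, μ j ≤ lam j ∧ lam (j + 1) ≤ μ j) :
    ∃ A B : Matrix (Fin n) (Fin n) ℂ, A ∈ unitaryGroup (Fin n) ℂ ∧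
      (Bᴴ = -B ∧ ∀ i j : Fin n, (i : ℕ) < n - 1 → (j : ℕ) < n - 1 → B i j = 0) ∧
      A * (Jmu n μ + B) * Aᴴ = Jlam n lam := by
  obtain ⟨m, rfl⟩ := Nat.exists_eq_add_of_le' hn
  obtain ⟨H, A, hH, hHb, hA, hAH⟩ := exists_bordered_hermitian_of_interlacing m
    (fun i => lam i) (fun i => μ i) fun j hj => by exact_mod_cast h j hj
  refine ⟨A, Complex.I • H - Jmu (m + 1) μ, hA, ⟨?_, fun i j hi hj => ?_⟩, ?_⟩
  · have hJ : (Jmu (m + 1) μ)ᴴ = -Jmu (m + 1) μ := by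
      rw [Jmu, diagonal_conjTranspose, ← sub_eq_zero, sub_neg_eq_add, diagonal_add]
      refine diagonal_eq_zero.2 (funext fun i => ?_)
      simp only [Pi.star_apply, Pi.zero_apply]
      split_ifs <;> simp
    rw [conjTranspose_sub, conjTranspose_smul, hJ, hH.eq]
    simp only [RCLike.star_def, Complex.conj_I, neg_smul]
    abel
  · rw [Matrix.sub_apply, Matrix.smul_apply, hHb i j hi hj, Jmu_apply_eq_diagonal μ i j hi,
      diagonal_apply]
    split_ifs <;> simp
  · rw [add_sub_cancel, Matrix.mul_smul, Matrix.smul_mul, hAH, Jlam, ← diagonal_smul]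
    congr 1

theorem stmt10 (n : ℕ) (hn : 1 ≤ n) (lam : ℕ → ℤ)
    (hlam : ∀ i, i + 1 < n → lam (i + 1) ≤ lam i)
    (muk : ℕ → ℕ → ℤ) (hmuk : ∀ k i, i + 1 < n - 1 → muk k (i + 1) ≤ muk k i)
    (rk : ℕ → ℝ) (hrk : ∀ k, 0 < rk k) :
    (∃ (A B : ℕ → Matrix (Fin n) (Fin n) ℂ),
        (∀ k, A k ∈ Matrix.unitaryGroup (Fin n) ℂ) ∧
        (∀ k, (B k)ᴴ = -(B k) ∧
          ∀ i j : Fin n, (i : ℕ) < n - 1 → (j : ℕ) < n - 1 → B k i j = 0) ∧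
        Tendsto (fun k =>
            ((A k) * (Jmu n (muk k) + B k) * (A k)ᴴ,
              (A k).mulVec (vr n (rk k)),
              (0 : ℝ)))
          atTop
          (nhds (Jlam n lam, (0 : Fin n → ℂ), (0 : ℝ))))
      ↔ (Tendsto rk atTop (nhds 0) ∧
          ∀ᶠ k in atTop, ∀ j < n - 1, muk k j ≤ lam j ∧ lam (j + 1) ≤ muk k j) := by
  constructor
  · rintro ⟨A, B, hA, hB, h⟩
    obtain ⟨hM, hv⟩ := (Prod.tendsto_iff _ _).1 h
    have hv := ((Prod.tendsto_iff _ _).1 hv).1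
    simp only at hM hv
    refine ⟨?_, ?_⟩
    · have hsq : Tendsto (fun k => ∑ i, ‖(A k *ᵥ vr n (rk k)) i‖ ^ 2) atTop (nhds 0) := by
        have := tendsto_finsetSum Finset.univ fun (i : Fin n) _ =>
          ((tendsto_pi_nhds.1 hv i).norm.pow 2)
        simpa using this
      have hsqrt := hsq.sqrt
      simp only [sum_norm_sq_mulVec_of_mem_unitaryGroup (hA _), sum_norm_sq_vr hn,
        Real.sqrt_sq (hrk _).le, Real.sqrt_zero] at hsqrt
      exact hsqrt
    · have hn0 : (0 : ℝ) < n := by exact_mod_cast hn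
      have hδ : (0 : ℝ) < 1 / (2 * n) := by positivity
      have hev : ∀ᶠ k in atTop, ∀ i j : Fin n,
          ‖(A k * (Jmu n (muk k) + B k) * (A k)ᴴ - Jlam n lam) i j‖ ≤ 1 / (2 * n) := by
        refine eventually_all.2 fun i => eventually_all.2 fun j => ?_
        have hij : Tendsto (fun k => (A k * (Jmu n (muk k) + B k) * (A k)ᴴ) i j) atTop
            (nhds (Jlam n lam i j)) := tendsto_pi_nhds.1 (tendsto_pi_nhds.1 hM i) j
        have := (tendsto_sub_nhds_zero_iff.2 hij).norm
        rw [norm_zero] at this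
        exact (this.eventually_lt_const hδ).mono fun k hk => hk.le
      refine hev.mono fun k hk => interlacing_of_close hlam (hmuk k) (hA k) (hB k).2 hδ.le ?_ hk
      field_simp
      norm_num
  · rintro ⟨hr, hev⟩
    have hex (k : ℕ) : ∃ A B : Matrix (Fin n) (Fin n) ℂ, A ∈ unitaryGroup (Fin n) ℂ ∧
        (Bᴴ = -B ∧ ∀ i j : Fin n, (i : ℕ) < n - 1 → (j : ℕ) < n - 1 → B i j = 0) ∧
        ((∀ j < n - 1, muk k j ≤ lam j ∧ lam (j + 1) ≤ muk k j) →
          A * (Jmu n (muk k) + B) * Aᴴ = Jlam n lam) := by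
      by_cases hk : ∀ j < n - 1, muk k j ≤ lam j ∧ lam (j + 1) ≤ muk k j
      · obtain ⟨A, B, hA, hB, hAB⟩ := exists_conj_Jmu_add_eq_Jlam hn lam (muk k) hk
        exact ⟨A, B, hA, hB, fun _ => hAB⟩
      · exact ⟨1, 0, one_mem _, by simp, fun h => absurd h hk⟩
    choose A B hA hB hAB using hex
    refine ⟨A, B, hA, hB, Tendsto.prodMk_nhds ?_ (Tendsto.prodMk_nhds ?_ tendsto_const_nhds)⟩
    · exact tendsto_nhds_of_eventually_eq (hev.mono fun k hk => hAB k hk)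
    · refine tendsto_pi_nhds.2 fun i => squeeze_zero_norm (fun k => ?_) hr
      refine le_of_sq_le_sq ?_ (hrk k).le
      rw [← sum_norm_sq_vr hn (rk k), ← sum_norm_sq_mulVec_of_mem_unitaryGroup (hA k)]
      exact Finset.single_le_sum (f := fun i => ‖(A k *ᵥ vr n (rk k)) i‖ ^ 2)
        (fun _ _ => by positivity) (Finset.mem_univ i)
end

section
/- Let n ≥ 1, μ ∈ P_{n−1} and r > 0. For A ∈ U(n), z ∈ ℂ^n and t ∈ ℝ, define the coadjoint action of the element (A,z,t) of U(n)⋉H_n on (U,u,x) (with U an n×n skew-Hermitian matrix, u ∈ ℂ^n, x ∈ ℝ) by Ad*(A,z,t)(U,u,x) = ( AUA* + z×(Au) + (x/2)·(z×z), Au + xz, x ), where z×w := (i/2)(wz* + zw*). Then Ad*(A,z,t)(J_μ, v_r, 0) = (J_μ, v_r, 0) holds if and only if: z = i·c·v_r for some c ∈ ℝ, A v_r = v_r, and A J_μ A* = J_μ. -/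
open Matrix

/-- `z × w = (i/2)(w z* + z w*)`, an `n × n` skew-Hermitian matrix. -/
noncomputable def cross {n : ℕ} (z w : Fin n → ℂ) : Matrix (Fin n) (Fin n) ℂ :=
  (Complex.I / 2) • (Matrix.vecMulVec w (star z) + Matrix.vecMulVec z (star w))

theorem Jmu_mulVec_vr (n : ℕ) (μ : ℕ → ℤ) (r : ℝ) : Jmu n μ *ᵥ vr n r = 0 := by
  ext i
  simp only [Jmu, vr, Matrix.mulVec_diagonal, Pi.zero_apply]
  split_ifs <;> first | omega | simp

theorem vr_ne_zero {n : ℕ} (hn : 1 ≤ n) {r : ℝ} (hr : r ≠ 0) : vr n r ≠ 0 := fun h =>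
  hr (by simpa [vr] using congrFun h ⟨n - 1, by omega⟩)

theorem cross_mulVec {n : ℕ} (z w u : Fin n → ℂ) :
    cross z w *ᵥ u = (Complex.I / 2) • ((star z ⬝ᵥ u) • w + (star w ⬝ᵥ u) • z) := by
  simp [cross, Matrix.smul_mulVec, Matrix.add_mulVec, Matrix.vecMulVec_mulVec]

theorem cross_I_mul_smul_self {n : ℕ} (c : ℝ) (v : Fin n → ℂ) :
    cross ((Complex.I * (c : ℂ)) • v) v = 0 := by
  ext i j
  simp [cross]

open scoped ComplexOrder in
/-- If `z × v` annihilates `v ≠ 0`, then `z` is a purely imaginary multiple of `v`. -/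
theorem exists_eq_I_mul_smul_of_cross_mulVec_eq_zero {n : ℕ} {z v : Fin n → ℂ} (hv : v ≠ 0)
    (h : cross z v *ᵥ v = 0) : ∃ c : ℝ, z = (Complex.I * (c : ℂ)) • v := by
  have hs : star v ⬝ᵥ v ≠ 0 := fun h0 => hv (dotProduct_star_self_eq_zero.1 h0)
  rw [cross_mulVec] at h
  have h2 : (star z ⬝ᵥ v) • v + (star v ⬝ᵥ v) • z = 0 :=
    (smul_eq_zero.1 h).resolve_left (by simp)
  obtain ⟨a, rfl⟩ : ∃ a : ℂ, z = a • v := by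
    refine ⟨-((star v ⬝ᵥ v)⁻¹ * (star z ⬝ᵥ v)), ?_⟩
    rw [neg_smul, mul_smul, eq_neg_of_add_eq_zero_left h2, smul_neg, neg_neg,
      inv_smul_smul₀ hs]
  have h3 : ((star a + a) * (star v ⬝ᵥ v)) • v = 0 := by
    rw [← h2, star_smul, smul_dotProduct, smul_smul, ← add_smul, smul_eq_mul]
    ring_nf
  have h4 : star a + a = 0 :=
    (mul_eq_zero.1 ((smul_eq_zero.1 h3).resolve_right hv)).resolve_right hs
  have hre : a.re = 0 := by
    have := congrArg Complex.re h4
    simp at this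
    linarith
  exact ⟨a.im, by congr 1; apply Complex.ext <;> simp [hre]⟩

theorem stmt11 (n : ℕ) (hn : 1 ≤ n) (μ : ℕ → ℤ)
    (hμ : ∀ i, i + 1 < n - 1 → μ (i + 1) ≤ μ i) (r : ℝ) (hr : 0 < r)
    (A : Matrix (Fin n) (Fin n) ℂ) (hA : A ∈ Matrix.unitaryGroup (Fin n) ℂ)
    (z : Fin n → ℂ) (t : ℝ) :
    ((A * Jmu n μ * Aᴴ + cross z (A.mulVec (vr n r)) + (((0 : ℝ) / 2 : ℝ) : ℂ) • cross z z,
        A.mulVec (vr n r) + (((0 : ℝ) : ℂ)) • z,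
        (0 : ℝ))
      = (Jmu n μ, vr n r, (0 : ℝ)))
      ↔ ((∃ c : ℝ, z = (Complex.I * (c : ℂ)) • vr n r) ∧
          A.mulVec (vr n r) = vr n r ∧
          A * Jmu n μ * Aᴴ = Jmu n μ) := by
  simp only [zero_div, Complex.ofReal_zero, zero_smul, add_zero, Prod.mk.injEq, and_true]
  constructor
  · rintro ⟨hJ, hv⟩
    rw [hv] at hJ
    have hv' : Aᴴ *ᵥ vr n r = vr n r := by
      have hAA : Aᴴ * A = 1 := Matrix.mem_unitaryGroup_iff'.1 hA
      conv_lhs => rw [← hv]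
      rw [Matrix.mulVec_mulVec, hAA, Matrix.one_mulVec]
    have hc : cross z (vr n r) *ᵥ vr n r = 0 := by
      have h := congrArg (· *ᵥ vr n r) hJ
      simpa only [Matrix.add_mulVec, ← Matrix.mulVec_mulVec, hv', Jmu_mulVec_vr,
        Matrix.mulVec_zero, zero_add] using h
    obtain ⟨c, rfl⟩ := exists_eq_I_mul_smul_of_cross_mulVec_eq_zero (vr_ne_zero hn hr.ne') hc
    rw [cross_I_mul_smul_self, add_zero] at hJ
    exact ⟨⟨c, rfl⟩, hv, hJ⟩
  · rintro ⟨⟨c, rfl⟩, hv, hJ⟩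
    rw [hv, cross_I_mul_smul_self, add_zero]
    exact ⟨hJ, rfl⟩
end

section
/- Let n ≥ 1, let λ₁,…,λₙ ∈ ℝ, and let μ₁,…,μ_{n−1} ∈ ℝ be pairwise distinct. Set x := Σ_{j=1}^{n} λ_j − Σ_{j=1}^{n−1} μ_j and, for each j ∈ {1,…,n−1}, c_j := − [ ∏_{i=1}^{n} (λ_i − μ_j) ] / [ ∏_{i=1, i≠j}^{n−1} (μ_i − μ_j) ]. Then for every k ∈ {1,…,n}: (λ_k − x)·∏_{i=1}^{n−1} (λ_k − μ_i) − Σ_{j=1}^{n−1} c_j·∏_{i=1, i≠j}^{n−1} (λ_k − μ_i) = 0. In other words, the polynomial P(y) = (y − x)·∏_{i=1}^{n−1}(y − μ_i) − Σ_{j=1}^{n−1} c_j·∏_{i≠j}(y − μ_i) vanishes at each λ_k. -/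
open Polynomial in
/-- Two monic polynomials of the same degree `d + 1` with the same next coefficient differ by a
polynomial of degree less than `d`. -/
theorem Polynomial.Monic.degree_sub_lt_of_nextCoeff_eq {R : Type*} [Ring R] {p q : R[X]} {d : ℕ}
    (hp : p.Monic) (hq : q.Monic) (hpd : p.natDegree = d + 1) (hqd : q.natDegree = d + 1)
    (h : p.nextCoeff = q.nextCoeff) : (p - q).degree < d := by
  rw [degree_lt_iff_coeff_zero]
  intro m hm
  rw [coeff_sub, sub_eq_zero]
  obtain rfl | rfl | hlt : m = d ∨ m = d + 1 ∨ d + 1 < m := by omega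
  · rwa [nextCoeff_of_natDegree_pos (by omega), nextCoeff_of_natDegree_pos (by omega),
      hpd, hqd] at h
  · have hp' := hp.coeff_natDegree
    have hq' := hq.coeff_natDegree
    rw [hpd] at hp'
    rw [hqd] at hq'
    rw [hp', hq']
  · rw [coeff_eq_zero_of_natDegree_lt (by omega), coeff_eq_zero_of_natDegree_lt (by omega)]

open Polynomial in
/-- Division with remainder of a nodal polynomial by one of degree one less, the remainder being
given by Lagrange interpolation. -/
theorem Lagrange.nodal_eq_mul_nodal_add_interpolate {F ι κ : Type*} [Field F] [DecidableEq ι]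
    {s : Finset ι} {t : Finset κ} {v : ι → F} (w : κ → F) (hv : Set.InjOn v s)
    (hcard : t.card = s.card + 1) :
    nodal t w = (X - C (∑ i ∈ t, w i - ∑ i ∈ s, v i)) * nodal s v +
      interpolate s v fun j => (nodal t w).eval (v j) := by
  rw [← sub_eq_iff_eq_add']
  refine eq_interpolate_of_eval_eq _ hv ?_ fun j hj => by simp [eval_nodal_at_node hj]
  have hlin := monic_X_sub_C (∑ i ∈ t, w i - ∑ i ∈ s, v i)
  have hs : (nodal s v).Monic := nodal_monic
  refine nodal_monic.degree_sub_lt_of_nextCoeff_eq (hlin.mul hs) (by rw [natDegree_nodal, hcard])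
    ?_ ?_
  · rw [hlin.natDegree_mul hs, natDegree_X_sub_C, natDegree_nodal, add_comm]
  · rw [hlin.nextCoeff_mul hs, nextCoeff_X_sub_C, nodal_eq, nodal_eq,
      prod_X_sub_C_nextCoeff, prod_X_sub_C_nextCoeff]
    ring

theorem stmt12 (n : ℕ) (hn : 1 ≤ n) (lam : ℕ → ℝ) (mu : ℕ → ℝ)
    (hmu : ∀ i ∈ Finset.Icc 1 (n - 1), ∀ j ∈ Finset.Icc 1 (n - 1), i ≠ j → mu i ≠ mu j)
    (k : ℕ) (hk : k ∈ Finset.Icc 1 n) :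
    (lam k - (∑ j ∈ Finset.Icc 1 n, lam j - ∑ j ∈ Finset.Icc 1 (n - 1), mu j)) *
        ∏ i ∈ Finset.Icc 1 (n - 1), (lam k - mu i)
      - ∑ j ∈ Finset.Icc 1 (n - 1),
          (-(∏ i ∈ Finset.Icc 1 n, (lam i - mu j)) /
              ∏ i ∈ (Finset.Icc 1 (n - 1)).erase j, (mu i - mu j)) *
            ∏ i ∈ (Finset.Icc 1 (n - 1)).erase j, (lam k - mu i)
      = 0 := by
  have hinj : Set.InjOn mu (Finset.Icc 1 (n - 1) : Finset ℕ) := fun i hi j hj h => by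
    by_contra hij
    exact hmu i hi j hj hij h
  have key := congrArg (Polynomial.eval (lam k))
    (Lagrange.nodal_eq_mul_nodal_add_interpolate (t := Finset.Icc 1 n) lam hinj
      (by simp only [Nat.card_Icc]; omega))
  rw [Lagrange.eval_nodal_at_node hk, Polynomial.eval_add, Polynomial.eval_mul,
    Lagrange.interpolate_apply, Polynomial.eval_finsetSum] at key
  simp only [Polynomial.eval_sub, Polynomial.eval_X, Polynomial.eval_C, Polynomial.eval_mul,
    Lagrange.eval_nodal] at key
  rw [key, sub_eq_add_neg, ← Finset.sum_neg_distrib]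
  congr 1
  refine Finset.sum_congr rfl fun j hj => ?_
  have hswap (u : Finset ℕ) (f : ℕ → ℝ) :
      ∏ i ∈ u, (f i - mu j) = (-1) ^ u.card * ∏ i ∈ u, (mu j - f i) := by
    rw [← Finset.prod_neg]
    simp only [neg_sub]
  have hcard : (Finset.Icc 1 n).card = ((Finset.Icc 1 (n - 1)).erase j).card + 2 := by
    rw [Finset.card_erase_of_mem hj]
    simp only [Finset.mem_Icc] at hj
    simp only [Nat.card_Icc]
    omega
  rw [hswap, hswap, hcard, Lagrange.basis, Polynomial.eval_prod]
  simp only [Lagrange.basisDivisor, Polynomial.eval_mul, Polynomial.eval_C, Polynomial.eval_sub,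
    Polynomial.eval_X, Finset.prod_mul_distrib, Finset.prod_inv_distrib]
  rw [pow_add, neg_one_sq, mul_one, neg_div, mul_div_mul_left _ _ (pow_ne_zero _ (by norm_num))]
  ring
end

section
/- Let n ≥ 1, α > 0, z ∈ ℂ^n and q = (q₁,…,qₙ) ∈ ℕ^n. Then (α/(2π))^n · (α^{|q|}/(2^{|q|}·q!)) · ∫_{ℂ^n} e^{−(α/2)⟨w,z⟩} · (z+w)^q · conj(w)^q · e^{−(α/2)|w|²} dw = Σ_{j ∈ ℕ^n, j ≤ q componentwise} (α/2)^{|j|} · (q!/(q−j)!) · [ ∏_{i=1}^{n} (−|z_i|²)^{j_i} ] / (j!)², where the integral is with respect to Lebesgue measure on ℂ^n ≅ ℝ^{2n}. -/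
open MeasureTheory

open scoped ComplexConjugate

lemma integrable_norm_pow_mul_exp_mul_exp_neg_mul_sq {a : ℝ} (ha : 0 < a) (k : ℕ) (C : ℝ) :
    Integrable (fun w : ℂ => ‖w‖ ^ k * Real.exp (C * ‖w‖) * Real.exp (-a * ‖w‖ ^ 2)) := by
  have hg : Integrable (fun w : ℂ => Real.exp (-(a / 2) * ‖w‖ ^ 2)) := by
    have h := (GaussianFourier.integrable_cexp_neg_mul_sq_norm_add (V := ℂ)
      (b := ((a / 2 : ℝ) : ℂ)) (by simpa using ha) 0 0).norm
    refine h.congr (.of_forall fun w => ?_)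
    simp only [Complex.norm_exp]
    congr 1
    simp [← Complex.ofReal_pow]
  refine (hg.const_mul (k.factorial * Real.exp ((C + 1) ^ 2 / (2 * a)))).mono'
    (by fun_prop) (.of_forall fun w => ?_)
  rw [Real.norm_of_nonneg (by positivity)]
  have hk : ‖w‖ ^ k ≤ k.factorial * Real.exp ‖w‖ := by
    have := Real.pow_div_factorial_le_exp ‖w‖ (norm_nonneg w) k
    rwa [div_le_iff₀' (by positivity)] at this
  calc ‖w‖ ^ k * Real.exp (C * ‖w‖) * Real.exp (-a * ‖w‖ ^ 2)
      ≤ k.factorial * Real.exp ‖w‖ * Real.exp (C * ‖w‖) * Real.exp (-a * ‖w‖ ^ 2) := by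
        gcongr
    _ = k.factorial * Real.exp (‖w‖ + C * ‖w‖ + -a * ‖w‖ ^ 2) := by
        rw [Real.exp_add, Real.exp_add]; ring
    _ ≤ k.factorial * Real.exp ((C + 1) ^ 2 / (2 * a) + -(a / 2) * ‖w‖ ^ 2) := by
        refine mul_le_mul_of_nonneg_left (Real.exp_le_exp.2 ?_) (by positivity)
        have h : (C + 1) ^ 2 / (2 * a) + -(a / 2) * ‖w‖ ^ 2 - (‖w‖ + C * ‖w‖ + -a * ‖w‖ ^ 2)
            = (C + 1 - a * ‖w‖) ^ 2 / (2 * a) := by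
          field_simp; ring
        have : 0 ≤ (C + 1 - a * ‖w‖) ^ 2 / (2 * a) := by positivity
        linarith
    _ = _ := by rw [Real.exp_add]; ring

lemma norm_cexp_neg_mul_mul_conj (a : ℝ) (w : ℂ) :
    ‖Complex.exp (-(a : ℂ) * (w * conj w))‖ = Real.exp (-a * ‖w‖ ^ 2) := by
  rw [Complex.norm_exp, Complex.mul_conj, Complex.normSq_eq_norm_sq]
  congr 1
  rw [← Complex.ofReal_neg, Complex.re_ofReal_mul, Complex.ofReal_re]

lemma integrable_cexp_mul_pow_mul_conj_pow_mul_gaussian {a : ℝ} (ha : 0 < a) (c : ℂ) (k q : ℕ) :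
    Integrable (fun w : ℂ =>
      Complex.exp (c * w) * w ^ k * conj w ^ q * Complex.exp (-(a : ℂ) * (w * conj w))) := by
  refine (integrable_norm_pow_mul_exp_mul_exp_neg_mul_sq ha (k + q) ‖c‖).mono'
    (Continuous.aestronglyMeasurable (by fun_prop)) (.of_forall fun w => ?_)
  rw [norm_mul, norm_cexp_neg_mul_mul_conj]
  have h : ‖Complex.exp (c * w)‖ ≤ Real.exp (‖c‖ * ‖w‖) := by
    simpa using Complex.norm_exp_le_exp_norm (c * w)
  simp only [norm_mul, norm_pow, RCLike.norm_conj]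
  calc _ ≤ Real.exp (‖c‖ * ‖w‖) * ‖w‖ ^ k * ‖w‖ ^ q * Real.exp (-a * ‖w‖ ^ 2) := by gcongr
    _ = _ := by rw [pow_add]; ring

lemma integral_pow_mul_conj_pow_mul_gaussian_of_ne {m q : ℕ} (h : m ≠ q) (a : ℝ) :
    ∫ w : ℂ, w ^ m * conj w ^ q * Complex.exp (-(a : ℂ) * (w * conj w)) = 0 := by
  set u : Circle := Circle.exp (Real.pi / ((m : ℝ) - q)) with hu
  have hmq : (m : ℂ) - q ≠ 0 := sub_ne_zero.2 (by exact_mod_cast h)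
  have hneg : (u : ℂ) ^ m * conj (u : ℂ) ^ q = -1 := by
    rw [hu, Circle.coe_exp, ← Complex.exp_conj, ← Complex.exp_nat_mul, ← Complex.exp_nat_mul,
      ← Complex.exp_add, ← Complex.exp_pi_mul_I]
    congr 1
    simp only [map_mul, Complex.conj_ofReal, Complex.conj_I]
    push_cast
    field_simp
    ring
  have huu : (u : ℂ) * conj (u : ℂ) = 1 := by
    rw [Complex.mul_conj]; simp
  have hrot := (rotation u).measurePreserving.integral_comp
    (rotation u).toHomeomorph.measurableEmbedding
    (fun w : ℂ => w ^ m * conj w ^ q * Complex.exp (-(a : ℂ) * (w * conj w)))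
  have hneg' : ∀ w : ℂ, (rotation u w) ^ m * conj (rotation u w) ^ q *
      Complex.exp (-(a : ℂ) * (rotation u w * conj (rotation u w)))
      = -(w ^ m * conj w ^ q * Complex.exp (-(a : ℂ) * (w * conj w))) := by
    intro w
    rw [rotation_apply, map_mul, mul_pow, mul_pow, mul_mul_mul_comm (u : ℂ) w, huu, one_mul,
      mul_mul_mul_comm, hneg]
    ring
  simp only [hneg', integral_neg] at hrot
  exact self_eq_neg.1 hrot.symm

lemma integral_pow_mul_conj_pow_mul_gaussian {a : ℝ} (ha : 0 < a) (q : ℕ) :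
    ∫ w : ℂ, w ^ q * conj w ^ q * Complex.exp (-(a : ℂ) * (w * conj w))
      = Real.pi * q.factorial / (a : ℂ) ^ (q + 1) := by
  have h := Complex.integral_rpow_mul_exp_neg_mul_rpow (p := 2) (q := 2 * q) (b := a)
    (by norm_num) (by have : (0 : ℝ) ≤ q := q.cast_nonneg
                      linarith) ha
  have e1 : -((2 * q + 2 : ℝ)) / 2 = -((q + 1 : ℕ) : ℝ) := by push_cast; ring
  have e2 : ((2 * q + 2 : ℝ)) / 2 = (q : ℝ) + 1 := by ring
  rw [e1, e2, Real.Gamma_nat_eq_factorial, Real.rpow_neg ha.le, Real.rpow_natCast] at h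
  have h' : ∀ w : ℂ, w ^ q * conj w ^ q * Complex.exp (-(a : ℂ) * (w * conj w))
      = ((‖w‖ ^ (2 * q : ℝ) * Real.exp (-a * ‖w‖ ^ (2 : ℝ)) : ℝ) : ℂ) := by
    intro w
    have : ‖w‖ ^ (2 * q : ℝ) = (‖w‖ ^ 2) ^ q := by
      rw [← pow_mul, ← Real.rpow_natCast]; push_cast; rfl
    rw [← mul_pow, Complex.mul_conj, Complex.normSq_eq_norm_sq, this, Real.rpow_two]
    push_cast
    rfl
  simp only [h']
  rw [integral_complex_ofReal, h]
  push_cast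
  field_simp

lemma integral_cexp_mul_pow_mul_conj_pow_mul_gaussian {a : ℝ} (ha : 0 < a) (c : ℂ) {k q : ℕ}
    (hk : k ≤ q) :
    ∫ w : ℂ, Complex.exp (c * w) * w ^ k * conj w ^ q * Complex.exp (-(a : ℂ) * (w * conj w))
      = c ^ (q - k) / (q - k).factorial * (Real.pi * q.factorial / (a : ℂ) ^ (q + 1)) := by
  set F : ℕ → ℂ → ℂ := fun m w =>
    c ^ m / m.factorial * (w ^ (m + k) * conj w ^ q * Complex.exp (-(a : ℂ) * (w * conj w)))
    with hF
  have hnorm : ∀ m w, ‖F m w‖ = (‖c‖ * ‖w‖) ^ m / m.factorial *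
      (‖w‖ ^ (k + q) * Real.exp (-a * ‖w‖ ^ 2)) := by
    intro m w
    simp only [hF, norm_mul, norm_div, norm_pow, RCLike.norm_conj, norm_cexp_neg_mul_mul_conj,
      Complex.norm_natCast]
    ring
  have hexp : ∀ x : ℝ, HasSum (fun m : ℕ => x ^ m / m.factorial) (Real.exp x) := by
    intro x
    rw [Real.exp_eq_exp_ℝ]
    exact NormedSpace.expSeries_div_hasSum_exp x
  have hbound : ∀ w : ℂ, HasSum (fun m => ‖F m w‖)
      (Real.exp (‖c‖ * ‖w‖) * (‖w‖ ^ (k + q) * Real.exp (-a * ‖w‖ ^ 2))) := by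
    intro w
    simp only [hnorm]
    exact (hexp _).mul_right _
  have hsum := hasSum_integral_of_dominated_convergence (μ := volume) (F := F)
    (f := fun w => Complex.exp (c * w) * w ^ k * conj w ^ q *
      Complex.exp (-(a : ℂ) * (w * conj w)))
    (fun m w => ‖F m w‖)
    (fun m => Continuous.aestronglyMeasurable (by simp only [hF]; fun_prop))
    (fun m => .of_forall fun w => le_rfl)
    (.of_forall fun w => (hbound w).summable)
    (by
      simp only [(hbound _).tsum_eq]
      refine (integrable_norm_pow_mul_exp_mul_exp_neg_mul_sq ha (k + q) ‖c‖).congr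
        (.of_forall fun w => ?_)
      ring)
    (.of_forall fun w => by
      have h : HasSum (fun m : ℕ => (c * w) ^ m / m.factorial) (Complex.exp (c * w)) := by
        rw [Complex.exp_eq_exp_ℂ]
        exact NormedSpace.expSeries_div_hasSum_exp (c * w)
      have := h.mul_right (w ^ k * conj w ^ q * Complex.exp (-(a : ℂ) * (w * conj w)))
      convert! this using 1
      · funext m
        simp only [hF]
        ring
      · ring)
  refine hsum.unique ?_
  have hval := hasSum_single (f := fun m => ∫ w, F m w) (q - k) (fun m hm => by
    simp only [hF, integral_const_mul]
    rw [integral_pow_mul_conj_pow_mul_gaussian_of_ne (by omega), mul_zero])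
  convert! hval using 1
  simp only [hF, integral_const_mul, Nat.sub_add_cancel hk]
  rw [integral_pow_mul_conj_pow_mul_gaussian ha]

lemma integral_cexp_mul_add_pow_mul_conj_pow_mul_gaussian {a : ℝ} (ha : 0 < a) (z : ℂ) (q : ℕ) :
    (a / Real.pi : ℂ) * ((a : ℂ) ^ q / q.factorial) *
      ∫ w : ℂ, Complex.exp (-(a : ℂ) * (w * conj z)) * (z + w) ^ q * conj w ^ q *
        Complex.exp (-(a : ℂ) * (w * conj w))
      = ∑ j ∈ Finset.range (q + 1), (a : ℂ) ^ j *
          ((q.factorial : ℂ) / ((q - j).factorial : ℂ)) *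
          (-((Complex.normSq z : ℝ) : ℂ)) ^ j / ((j.factorial : ℂ) ^ 2) := by
  have hexpand : ∀ w : ℂ, Complex.exp (-(a : ℂ) * (w * conj z)) * (z + w) ^ q * conj w ^ q *
        Complex.exp (-(a : ℂ) * (w * conj w))
      = ∑ j ∈ Finset.range (q + 1), z ^ j * q.choose j *
          (Complex.exp ((-(a : ℂ) * conj z) * w) * w ^ (q - j) * conj w ^ q *
            Complex.exp (-(a : ℂ) * (w * conj w))) := by
    intro w
    rw [add_pow, Finset.mul_sum, Finset.sum_mul, Finset.sum_mul]
    refine Finset.sum_congr rfl fun j _ => ?_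
    rw [show -(a : ℂ) * (w * conj z) = (-(a : ℂ) * conj z) * w by ring]
    ring
  simp only [hexpand]
  rw [integral_finsetSum _ fun j _ =>
    (integrable_cexp_mul_pow_mul_conj_pow_mul_gaussian ha _ _ _).const_mul _, Finset.mul_sum]
  refine Finset.sum_congr rfl fun j hj => ?_
  have hjq : j ≤ q := Nat.lt_succ_iff.1 (Finset.mem_range.1 hj)
  rw [integral_const_mul, integral_cexp_mul_pow_mul_conj_pow_mul_gaussian ha _ (Nat.sub_le q j),
    Nat.sub_sub_self hjq, Nat.cast_choose ℂ hjq, ← Complex.mul_conj,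
    show -(z * conj z) = z * -conj z by ring, show -(a : ℂ) * conj z = a * -conj z by ring,
    mul_pow, mul_pow]
  have ha' : (a : ℂ) ≠ 0 := by exact_mod_cast ha.ne'
  have hpi : (Real.pi : ℂ) ≠ 0 := by exact_mod_cast Real.pi_ne_zero
  have h1 : (q.factorial : ℂ) ≠ 0 := by exact_mod_cast q.factorial_ne_zero
  have h2 : (j.factorial : ℂ) ≠ 0 := by exact_mod_cast j.factorial_ne_zero
  have h3 : ((q - j).factorial : ℂ) ≠ 0 := by exact_mod_cast (q - j).factorial_ne_zero
  field_simp
  ring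

theorem stmt14 (n : ℕ) (hn : 1 ≤ n) (α : ℝ) (hα : 0 < α) (z : Fin n → ℂ) (q : Fin n → ℕ) :
    (((α / (2 * Real.pi) : ℝ)) : ℂ) ^ n *
        ((α : ℂ) ^ (∑ i, q i) /
          ((2 : ℂ) ^ (∑ i, q i) * ((∏ i, Nat.factorial (q i) : ℕ) : ℂ))) *
        ∫ w : Fin n → ℂ,
          Complex.exp (-((α : ℂ) / 2) * ∑ i, w i * (starRingEnd ℂ) (z i)) *
            (∏ i, (z i + w i) ^ q i) * (∏ i, ((starRingEnd ℂ) (w i)) ^ q i) *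
            Complex.exp (-((α : ℂ) / 2) * ∑ i, w i * (starRingEnd ℂ) (w i))
      = ∑ j ∈ Fintype.piFinset (fun i => Finset.range (q i + 1)),
          ((α / 2 : ℝ) : ℂ) ^ (∑ i, j i) *
            (((∏ i, Nat.factorial (q i) : ℕ) : ℂ) /
              ((∏ i, Nat.factorial (q i - j i) : ℕ) : ℂ)) *
            (∏ i, (-((Complex.normSq (z i) : ℝ) : ℂ)) ^ j i) /
            (((∏ i, Nat.factorial (j i) : ℕ) : ℂ) ^ 2) := by
  set a : ℝ := α / 2 with ha_def
  have ha : 0 < a := half_pos hα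
  have hα2 : (α : ℂ) / 2 = (a : ℂ) := by rw [ha_def]; push_cast; rfl
  have hprod : ∀ w : Fin n → ℂ,
      Complex.exp (-((α : ℂ) / 2) * ∑ i, w i * conj (z i)) *
        (∏ i, (z i + w i) ^ q i) * (∏ i, (conj (w i)) ^ q i) *
        Complex.exp (-((α : ℂ) / 2) * ∑ i, w i * conj (w i))
      = ∏ i, (Complex.exp (-(a : ℂ) * (w i * conj (z i))) * (z i + w i) ^ q i *
          conj (w i) ^ q i * Complex.exp (-(a : ℂ) * (w i * conj (w i)))) := by
    intro w
    simp only [hα2, Finset.mul_sum, Complex.exp_sum, Finset.prod_mul_distrib]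
  have hconst : (((α / (2 * Real.pi) : ℝ)) : ℂ) ^ n *
        ((α : ℂ) ^ (∑ i, q i) / ((2 : ℂ) ^ (∑ i, q i) * ((∏ i, Nat.factorial (q i) : ℕ) : ℂ)))
      = ∏ i, ((a / Real.pi : ℂ) * ((a : ℂ) ^ q i / (q i).factorial)) := by
    rw [Finset.prod_mul_distrib, Finset.prod_div_distrib (f := fun i => (a : ℂ) ^ q i),
      Finset.prod_pow_eq_pow_sum, Finset.prod_const, Finset.card_univ, Fintype.card_fin,
      ← div_div ((α : ℂ) ^ ∑ i, q i), ← div_pow, hα2, ← div_div α, ← ha_def]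
    push_cast
    rfl
  simp only [hprod]
  rw [hconst, integral_fintype_prod_volume_eq_prod (fun i (w : ℂ) =>
    Complex.exp (-(a : ℂ) * (w * conj (z i))) * (z i + w) ^ q i *
      conj w ^ q i * Complex.exp (-(a : ℂ) * (w * conj w))), ← Finset.prod_mul_distrib]
  simp only [integral_cexp_mul_add_pow_mul_conj_pow_mul_gaussian ha]
  rw [Finset.prod_univ_sum]
  refine Finset.sum_congr rfl fun j _ => ?_
  rw [Finset.prod_div_distrib, Finset.prod_mul_distrib, Finset.prod_mul_distrib,
    Finset.prod_div_distrib, Finset.prod_pow_eq_pow_sum, Finset.prod_pow]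
  push_cast
  rfl
end

section
/- Let n ≥ 1 and define ψ on the set { (s₁,…,s_{n−1}, t₁,…,tₙ, ρ) : 0 < s_i < 1 for all i, s₁+…+s_{n−1} < 1, t_j ∈ ℝ, 0 < ρ ≤ 1 } with values in ℝ^{2n} by ψ(s,t,ρ) := ρ·( √s₁ cos t₁, √s₁ sin t₁, …, √s_{n−1} cos t_{n−1}, √s_{n−1} sin t_{n−1}, √(1−s) cos tₙ, √(1−s) sin tₙ ), where s = s₁+…+s_{n−1}. Then at every point of this set, ψ is differentiable and the absolute value of the determinant of its Jacobian (total derivative, a linear map ℝ^{2n} → ℝ^{2n}) equals ρ^{2n−1} / 2^{n−1}. -/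
/-- The `i`-th coordinate (`0 ≤ i < 2n`) of a point of `ℝ^{2n}`; the first `n-1` coordinates
are the variables `s₁,…,s_{n-1}`, the next `n` coordinates are the angles `t₁,…,tₙ` and the
last coordinate is the radius `ρ`. -/
noncomputable def coordS (n : ℕ) (p : Fin (2 * n) → ℝ) (i : ℕ) : ℝ :=
  if h : i < 2 * n then p ⟨i, h⟩ else 0

/-- The polar-type parametrization `ψ` of the `2n`-dimensional real unit ball, viewed as a map
`ℝ^{2n} → ℝ^{2n}`: the coordinates `2i, 2i+1` of the image (for `0 ≤ i ≤ n-1`) are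
`ρ √(sᵢ) cos(tᵢ)` and `ρ √(sᵢ) sin(tᵢ)` respectively, where `s_{n-1} := 1 - (s₁ + … + s_{n-1})`. -/
noncomputable def psiMap (n : ℕ) : (Fin (2 * n) → ℝ) → (Fin (2 * n) → ℝ) := fun p m =>
  let ρ : ℝ := coordS n p (2 * n - 1)
  let i : ℕ := (m : ℕ) / 2
  let rad : ℝ :=
    if i < n - 1 then Real.sqrt (coordS n p i)
    else Real.sqrt (1 - ∑ j ∈ Finset.range (n - 1), coordS n p j)
  let ang : ℝ := coordS n p (n - 1 + i)
  if (m : ℕ) % 2 = 0 then ρ * rad * Real.cos ang else ρ * rad * Real.sin ang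

open Matrix in
theorem hasFDerivAt_reindex {ι κ : Type*} [Fintype ι] [DecidableEq ι] [Fintype κ] [DecidableEq κ]
    (e₁ e₂ : ι ≃ κ) {g : (ι → ℝ) → ι → ℝ} {M : Matrix ι ι ℝ} {x : κ → ℝ}
    (hg : HasFDerivAt g (LinearMap.toContinuousLinearMap (toLin' M)) (x ∘ e₂)) :
    HasFDerivAt (fun y : κ → ℝ => g (y ∘ e₂) ∘ e₁.symm)
      (LinearMap.toContinuousLinearMap (toLin' (M.submatrix e₁.symm e₂.symm))) x := by
  have h₂ : HasFDerivAt (fun y : κ → ℝ => y ∘ e₂)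
      (LinearMap.toContinuousLinearMap (LinearMap.funLeft ℝ ℝ e₂)) x :=
    (LinearMap.toContinuousLinearMap (LinearMap.funLeft ℝ ℝ e₂)).hasFDerivAt
  have h₁ : HasFDerivAt (fun y : ι → ℝ => y ∘ e₁.symm)
      (LinearMap.toContinuousLinearMap (LinearMap.funLeft ℝ ℝ e₁.symm)) (g (x ∘ e₂)) :=
    (LinearMap.toContinuousLinearMap (LinearMap.funLeft ℝ ℝ e₁.symm)).hasFDerivAt
  refine (h₁.comp x (hg.comp x h₂)).congr_fderiv ?_
  ext v : 1
  change (M *ᵥ (v ∘ e₂)) ∘ e₁.symm = M.submatrix e₁.symm e₂.symm *ᵥ v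
  rw [submatrix_mulVec_equiv, Equiv.symm_symm]

section Polar

variable {κ : Type*} [Fintype κ]

/-- The squared radii `s₁, …, s_{n-1}, 1 - (s₁ + … + s_{n-1})`. The variables are indexed by
`(κ ⊕ Unit) ⊕ (κ ⊕ Unit)`: the `s`-variables, the radius, and the angles. -/
def sqRadius (x : (κ ⊕ Unit) ⊕ (κ ⊕ Unit) → ℝ) : κ ⊕ Unit → ℝ :=
  Sum.elim (fun i => x (.inl (.inl i))) fun _ => 1 - ∑ i, x (.inl (.inl i))

/-- The polar-type parametrization, with cosine and sine components grouped into two blocks. -/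
noncomputable def polarMap (x : (κ ⊕ Unit) ⊕ (κ ⊕ Unit) → ℝ) : (κ ⊕ Unit) ⊕ (κ ⊕ Unit) → ℝ :=
  Sum.elim
    (fun a => x (.inl (.inr ())) * √(sqRadius x a) * Real.cos (x (.inr a)))
    fun a => x (.inl (.inr ())) * √(sqRadius x a) * Real.sin (x (.inr a))

/-- The differential of `sqRadius`. -/
noncomputable def sqRadiusDeriv :
    κ ⊕ Unit → ((κ ⊕ Unit) ⊕ (κ ⊕ Unit) → ℝ) →L[ℝ] ℝ :=
  Sum.elim (fun i => ContinuousLinearMap.proj (.inl (.inl i)))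
    fun _ => -∑ i, ContinuousLinearMap.proj (.inl (.inl i))

theorem hasFDerivAt_sqRadius (x : (κ ⊕ Unit) ⊕ (κ ⊕ Unit) → ℝ) (a : κ ⊕ Unit) :
    HasFDerivAt (fun y => sqRadius y a) (sqRadiusDeriv a) x := by
  rcases a with i | _
  · exact hasFDerivAt_apply (𝕜 := ℝ) (F' := fun _ => ℝ) _ x
  · exact (HasFDerivAt.fun_sum fun i _ =>
      hasFDerivAt_apply (𝕜 := ℝ) (F' := fun _ => ℝ) _ x).const_sub 1

variable [DecidableEq κ]

open Matrix

/-- The matrix applying a rotation by the angle `t a` in each plane. -/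
noncomputable def planeRotations {ι : Type*} [DecidableEq ι] (t : ι → ℝ) :
    Matrix (ι ⊕ ι) (ι ⊕ ι) ℝ :=
  fromBlocks (diagonal fun a => Real.cos (t a)) (-diagonal fun a => Real.sin (t a))
    (diagonal fun a => Real.sin (t a)) (diagonal fun a => Real.cos (t a))

theorem abs_det_planeRotations {ι : Type*} [Fintype ι] [DecidableEq ι] (t : ι → ℝ) :
    |(planeRotations t).det| = 1 := by
  have h : planeRotations t * (planeRotations t)ᵀ = 1 := by
    simp only [planeRotations, fromBlocks_transpose, fromBlocks_multiply, diagonal_transpose,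
      transpose_neg, diagonal_mul_diagonal, Matrix.neg_mul, Matrix.mul_neg, neg_neg,
      ← fromBlocks_one, diagonal_add, mul_comm (Real.sin _) (Real.cos _), add_neg_cancel]
    simp [← sq]
  have h' := congrArg det h
  rw [det_mul, det_transpose, det_one, ← sq] at h'
  rwa [← sq_abs, pow_eq_one_iff_of_nonneg (abs_nonneg _) two_ne_zero] at h'

/-- The Jacobian matrix of `(s, ρ) ↦ ρ √s_a`, with the row `a` multiplied by `√s_a`. -/
noncomputable def radialMatrix (x : (κ ⊕ Unit) ⊕ (κ ⊕ Unit) → ℝ) :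
    Matrix (κ ⊕ Unit) (κ ⊕ Unit) ℝ :=
  fromBlocks (diagonal fun _ => x (.inl (.inr ())) / 2) (of fun i _ => sqRadius x (.inl i))
    (of fun _ _ => -(x (.inl (.inr ())) / 2)) (of fun _ _ => sqRadius x (.inr ()))

theorem det_radialMatrix (x : (κ ⊕ Unit) ⊕ (κ ⊕ Unit) → ℝ) :
    (radialMatrix x).det = (x (.inl (.inr ())) / 2) ^ Fintype.card κ := by
  have h : fromBlocks 1 0 (of fun (_ : Unit) (_ : κ) => (1 : ℝ)) 1 * radialMatrix x =
      fromBlocks (diagonal fun _ => x (.inl (.inr ())) / 2) (of fun i _ => sqRadius x (.inl i))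
        0 1 := by
    rw [radialMatrix, fromBlocks_multiply]
    congr 1
    · simp
    · simp
    · ext; simp [mul_apply, diagonal_apply]
    · ext; simp [mul_apply, sqRadius]
  simpa [div_pow] using congrArg det h

theorem radialMatrix_mulVec (x v : (κ ⊕ Unit) ⊕ (κ ⊕ Unit) → ℝ) (a : κ ⊕ Unit) :
    (radialMatrix x *ᵥ (v ∘ .inl)) a =
      x (.inl (.inr ())) / 2 * sqRadiusDeriv a v + sqRadius x a * v (.inl (.inr ())) := by
  rcases a with i | _ <;>
    simp [radialMatrix, sqRadiusDeriv, mulVec, dotProduct,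
    Finset.mul_sum, diagonal_apply]

/-- The Jacobian matrix of `polarMap`. -/
noncomputable def polarJacobian (x : (κ ⊕ Unit) ⊕ (κ ⊕ Unit) → ℝ) :
    Matrix ((κ ⊕ Unit) ⊕ (κ ⊕ Unit)) ((κ ⊕ Unit) ⊕ (κ ⊕ Unit)) ℝ :=
  planeRotations (x ∘ .inr) *
    fromBlocks (diagonal (fun a => (√(sqRadius x a))⁻¹) * radialMatrix x) 0 0
      (diagonal fun a => x (.inl (.inr ())) * √(sqRadius x a))

theorem hasFDerivAt_polarMap {x : (κ ⊕ Unit) ⊕ (κ ⊕ Unit) → ℝ} (hx : ∀ a, 0 < sqRadius x a) :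
    HasFDerivAt polarMap (LinearMap.toContinuousLinearMap (toLin' (polarJacobian x))) x := by
  have hρ := hasFDerivAt_apply (𝕜 := ℝ) (F' := fun _ : (κ ⊕ Unit) ⊕ (κ ⊕ Unit) => ℝ)
    (.inl (.inr ())) x
  have ht (a : κ ⊕ Unit) :=
    hasFDerivAt_apply (𝕜 := ℝ) (F' := fun _ : (κ ⊕ Unit) ⊕ (κ ⊕ Unit) => ℝ) (.inr a) x
  have hr (a : κ ⊕ Unit) := hρ.mul ((hasFDerivAt_sqRadius x a).sqrt (hx a).ne')
  have hsq (a : κ ⊕ Unit) : √(sqRadius x a) ^ 2 = sqRadius x a := Real.sq_sqrt (hx a).le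
  have hne (a : κ ⊕ Unit) : √(sqRadius x a) ≠ 0 := (Real.sqrt_pos.2 (hx a)).ne'
  refine hasFDerivAt_pi'.2 ?_
  rintro (a | a)
  · refine ((hr a).mul (ht a).cos).congr_fderiv ?_
    ext v : 1
    simp [polarJacobian, planeRotations, ← mulVec_mulVec, fromBlocks_mulVec, mulVec_diagonal,
      radialMatrix_mulVec]
    have := hne a
    field_simp
    rw [hsq]
    ring
  · refine ((hr a).mul (ht a).sin).congr_fderiv ?_
    ext v : 1
    simp [polarJacobian, planeRotations, ← mulVec_mulVec, fromBlocks_mulVec, mulVec_diagonal,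
      radialMatrix_mulVec]
    have := hne a
    field_simp
    rw [hsq]
    ring

theorem abs_det_polarJacobian {x : (κ ⊕ Unit) ⊕ (κ ⊕ Unit) → ℝ} (hx : ∀ a, 0 < sqRadius x a)
    (hρ : 0 < x (.inl (.inr ()))) :
    |(polarJacobian x).det| =
      x (.inl (.inr ())) ^ (2 * Fintype.card κ + 1) / 2 ^ Fintype.card κ := by
  have hne : ∏ a, √(sqRadius x a) ≠ 0 :=
    Finset.prod_ne_zero_iff.2 fun a _ => (Real.sqrt_pos.2 (hx a)).ne'
  have h : (∏ a, (√(sqRadius x a))⁻¹) * (x (.inl (.inr ())) / 2) ^ Fintype.card κ *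
      ∏ a, x (.inl (.inr ())) * √(sqRadius x a) =
      x (.inl (.inr ())) ^ (2 * Fintype.card κ + 1) / 2 ^ Fintype.card κ := by
    rw [div_pow, Finset.prod_inv_distrib, Finset.prod_mul_distrib, Finset.prod_const, Finset.card_univ,
      Fintype.card_sum, Fintype.card_unit]
    field_simp
    ring
  rw [polarJacobian, det_mul, abs_mul, abs_det_planeRotations, one_mul, det_fromBlocks_zero₂₁,
    det_mul, det_diagonal, det_diagonal, det_radialMatrix, h]
  exact abs_of_pos (by positivity)

end Polar

/-- The position of the cosine and sine components among the coordinates of `ψ`. -/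
noncomputable def componentEquiv (k : ℕ) : (Fin k ⊕ Unit) ⊕ (Fin k ⊕ Unit) ≃ Fin (2 * (k + 1)) :=
  .ofBijective
    (Sum.elim
      (Sum.elim (fun i => ⟨2 * i, by omega⟩) fun _ => ⟨2 * k, by omega⟩)
      (Sum.elim (fun i => ⟨2 * i + 1, by omega⟩) fun _ => ⟨2 * k + 1, by omega⟩)) <| by
    rw [Fintype.bijective_iff_injective_and_card]
    refine ⟨?_, by simp; omega⟩
    rintro ((i | _) | (i | _)) ((j | _) | (j | _)) h <;>
      simp [Fin.ext_iff] at h ⊢ <;> omega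

/-- The position of the variables of `polarMap` among the variables of `ψ`. -/
noncomputable def variableEquiv (k : ℕ) : (Fin k ⊕ Unit) ⊕ (Fin k ⊕ Unit) ≃ Fin (2 * (k + 1)) :=
  .ofBijective
    (Sum.elim
      (Sum.elim (fun i => ⟨i, by omega⟩) fun _ => ⟨2 * k + 1, by omega⟩)
      (Sum.elim (fun i => ⟨k + i, by omega⟩) fun _ => ⟨k + k, by omega⟩)) <| by
    rw [Fintype.bijective_iff_injective_and_card]
    refine ⟨?_, by simp; omega⟩
    rintro ((i | _) | (i | _)) ((j | _) | (j | _)) h <;>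
      simp [Fin.ext_iff] at h ⊢ <;> omega

theorem coordS_of_lt {n i : ℕ} (p : Fin (2 * n) → ℝ) (h : i < 2 * n) : coordS n p i = p ⟨i, h⟩ :=
  dif_pos h

theorem sum_range_coordS (k : ℕ) (p : Fin (2 * (k + 1)) → ℝ) :
    ∑ j ∈ Finset.range k, coordS (k + 1) p j = ∑ i, p (variableEquiv k (.inl (.inl i))) := by
  rw [Finset.sum_range]
  exact Finset.sum_congr rfl fun i _ => coordS_of_lt p (by omega)

theorem psiMap_eq (k : ℕ) :
    psiMap (k + 1) = fun p => polarMap (p ∘ variableEquiv k) ∘ (componentEquiv k).symm := by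
  funext p m
  obtain ⟨m, rfl⟩ := (componentEquiv k).surjective m
  have hρ : coordS (k + 1) p (2 * k + 1) = p (variableEquiv k (.inl (.inr ()))) :=
    coordS_of_lt p (by omega)
  have hs (i : Fin k) : coordS (k + 1) p i = p (variableEquiv k (.inl (.inl i))) :=
    coordS_of_lt p (by omega)
  have ht (i : Fin k) : coordS (k + 1) p (k + i) = p (variableEquiv k (.inr (.inl i))) :=
    coordS_of_lt p (by omega)
  have ht' : coordS (k + 1) p (k + k) = p (variableEquiv k (.inr (.inr ()))) :=
    coordS_of_lt p (by omega)
  have hk : 2 * (k + 1) - 1 = 2 * k + 1 := by omega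
  have hd (i : ℕ) : (2 * i + 1) / 2 = i := by omega
  have hm (i : ℕ) : (2 * i + 1) % 2 = 1 := by omega
  simp only [Function.comp_apply, Equiv.symm_apply_apply]
  rcases m with (i | _) | (i | _) <;>
    simp [psiMap, componentEquiv, polarMap, sqRadius, hk, hd, hm, hρ, hs, ht, ht',
      sum_range_coordS]

theorem stmt16 (n : ℕ) (hn : 1 ≤ n) (p : Fin (2 * n) → ℝ)
    (hs : ∀ i < n - 1, 0 < coordS n p i ∧ coordS n p i < 1)
    (hsum : ∑ i ∈ Finset.range (n - 1), coordS n p i < 1)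
    (hρ : 0 < coordS n p (2 * n - 1) ∧ coordS n p (2 * n - 1) ≤ 1) :
    ∃ L : (Fin (2 * n) → ℝ) →L[ℝ] (Fin (2 * n) → ℝ),
      HasFDerivAt (psiMap n) L p ∧
      |LinearMap.det (L : (Fin (2 * n) → ℝ) →ₗ[ℝ] (Fin (2 * n) → ℝ))|
        = (coordS n p (2 * n - 1)) ^ (2 * n - 1) / 2 ^ (n - 1) := by
  obtain ⟨k, rfl⟩ := Nat.exists_eq_add_of_le' hn
  have hk : 2 * (k + 1) - 1 = 2 * k + 1 := by omega
  simp only [hk, Nat.add_sub_cancel] at hs hsum hρ ⊢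
  have hρ' : coordS (k + 1) p (2 * k + 1) = (p ∘ variableEquiv k) (.inl (.inr ())) :=
    coordS_of_lt p (by omega)
  have hx (a : Fin k ⊕ Unit) : 0 < sqRadius (p ∘ variableEquiv k) a := by
    rcases a with i | _
    · exact (hs i i.2).1.trans_eq (coordS_of_lt p (by omega))
    · rw [sum_range_coordS] at hsum
      exact sub_pos.2 hsum
  refine ⟨_, psiMap_eq k ▸
    hasFDerivAt_reindex (componentEquiv k) (variableEquiv k) (hasFDerivAt_polarMap hx), ?_⟩
  rw [hρ'] at hρ ⊢
  rw [LinearMap.coe_toContinuousLinearMap, LinearMap.det_toLin',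
    Matrix.abs_det_submatrix_equiv_equiv, abs_det_polarJacobian hx hρ.1, Fintype.card_fin]
end

section
/- Let n ≥ 1, let Δ := { s ∈ [0,1]^{n−1} : s₁+…+s_{n−1} ≤ 1 }, and define ψ₁: Δ × [0,2π)^n → ℂ^n by ψ₁(s,t) := ( √s₁·e^{it₁}, …, √s_{n−1}·e^{it_{n−1}}, √(1−s)·e^{itₙ} ), where s = s₁+…+s_{n−1}; ψ₁ takes values in the unit sphere of ℂ^n. Then for every continuous function f on the closed unit ball B of ℂ^n ≅ ℝ^{2n}: ∫_{B} f(z) dz = (1/2^{n−1}) · ∫_0^1 ρ^{2n−1} ( ∫_{Δ × [0,2π)^n} f(ρ·ψ₁(s,t)) ds dt ) dρ, where dz is Lebesgue measure on ℝ^{2n} and ds dt is Lebesgue measure on Δ × [0,2π)^n. -/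
open MeasureTheory

/-- The parametrization `ψ₁(s,t) = (√s₁ e^{it₁}, …, √s_{n-1} e^{it_{n-1}}, √(1-s) e^{itₙ})`
of the unit sphere of `ℂ^n`, where `s = s₁ + … + s_{n-1}`. -/
noncomputable def psi1 (n : ℕ) : ((Fin (n - 1) → ℝ) × (Fin n → ℝ)) → (Fin n → ℂ) := fun p i =>
  if h : (i : ℕ) < n - 1 then
    ((Real.sqrt (p.1 ⟨(i : ℕ), h⟩) : ℝ) : ℂ) * Complex.exp (Complex.I * ((p.2 i : ℝ) : ℂ))
  else
    ((Real.sqrt (1 - ∑ j, p.1 j) : ℝ) : ℂ) * Complex.exp (Complex.I * ((p.2 i : ℝ) : ℂ))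

theorem lintegral_Ioi_eq_lintegral_sq (h : ℝ → ENNReal) :
    ∫⁻ r in Set.Ioi (0 : ℝ), h r
      = ∫⁻ x in Set.Ioi (0 : ℝ), ENNReal.ofReal (2 * x) * h (x ^ 2) := by
  have himg : (fun x : ℝ => x ^ 2) '' Set.Ioi 0 = Set.Ioi 0 := by
    ext y
    refine ⟨?_, fun hy => ⟨√y, Real.sqrt_pos.2 hy, Real.sq_sqrt (le_of_lt hy)⟩⟩
    rintro ⟨x, hx, rfl⟩
    exact pow_pos (Set.mem_Ioi.1 hx) 2
  have hinj : Set.InjOn (fun x : ℝ => x ^ 2) (Set.Ioi 0) := fun x hx y hy hxy =>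
    (pow_left_inj₀ (le_of_lt hx) (le_of_lt hy) two_ne_zero).1 hxy
  have key := lintegral_image_eq_lintegral_abs_deriv_mul (f' := fun x : ℝ => 2 * x)
    measurableSet_Ioi (fun x _ => by simpa using (hasDerivAt_pow 2 x).hasDerivWithinAt) hinj h
  rw [himg] at key
  rw [key]
  refine setLIntegral_congr_fun measurableSet_Ioi fun x hx => ?_
  have hx' : (0 : ℝ) < x := hx
  simp only [abs_of_pos (mul_pos two_pos hx')]

theorem lintegral_ofReal_mul_Ioi (h : ℝ → ENNReal) :
    ∫⁻ r in Set.Ioi (0 : ℝ), ENNReal.ofReal r * h r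
      = 2⁻¹ * ∫⁻ u in Set.Ioi (0 : ℝ), h √u := by
  rw [lintegral_Ioi_eq_lintegral_sq (fun u => h √u), ← lintegral_const_mul' _ _ (by simp)]
  refine setLIntegral_congr_fun measurableSet_Ioi fun x hx => ?_
  have hx' : (0 : ℝ) < x := hx
  simp only [Real.sqrt_sq hx'.le]
  rw [ENNReal.ofReal_mul two_pos.le, ← mul_assoc, ← mul_assoc, ENNReal.ofReal_ofNat,
    ENNReal.inv_mul_cancel two_ne_zero ENNReal.ofNat_ne_top, one_mul]

theorem lintegral_Ioo_neg_pi_pi_exp (k : ℂ → ENNReal) :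
    ∫⁻ t in Set.Ioo (-Real.pi) Real.pi, k (Complex.exp (Complex.I * t))
      = ∫⁻ t in Set.Ico 0 (2 * Real.pi), k (Complex.exp (Complex.I * t)) := by
  have h1 := isAddFundamentalDomain_Ioc Real.two_pi_pos (-Real.pi)
  have h2 := isAddFundamentalDomain_Ioc Real.two_pi_pos 0
  rw [Measure.restrict_congr_set Ioo_ae_eq_Ioc, Measure.restrict_congr_set Ico_ae_eq_Ioc]
  rw [show -Real.pi + 2 * Real.pi = Real.pi by ring] at h1
  rw [zero_add] at h2
  refine h1.setLIntegral_eq h2 _ ?_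
  rintro ⟨_, m, rfl⟩ x
  congr 1
  rw [Complex.exp_eq_exp_iff_exists_int]
  refine ⟨m, ?_⟩
  simp [AddSubgroup.vadd_def]
  ring

/-- A squared radius and an angle determine a complex number. -/
noncomputable def sqrtPolar (p : ℝ × ℝ) : ℂ := (√p.1 : ℂ) * Complex.exp (Complex.I * p.2)

theorem continuous_sqrtPolar : Continuous sqrtPolar := by
  unfold sqrtPolar
  fun_prop

theorem map_sqrtPolar :
    Measure.map sqrtPolar (((2⁻¹ : ENNReal) • volume.restrict (Set.Ici (0 : ℝ))).prod
      (volume.restrict (Set.Ico (0 : ℝ) (2 * Real.pi)))) = volume := by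
  refine (Measure.ext_of_lintegral _ fun f hf => ?_)
  have hm := continuous_sqrtPolar.measurable
  rw [lintegral_map hf hm, lintegral_prod (fun p => f (sqrtPolar p)) (hf.comp hm).aemeasurable, lintegral_smul_measure,
    Measure.restrict_congr_set Ioi_ae_eq_Ici.symm, smul_eq_mul,
    ← Complex.lintegral_comp_polarCoord_symm, polarCoord_target, Measure.volume_eq_prod,
    ← Measure.prod_restrict, lintegral_prod]
  · simp only [sqrtPolar]
    rw [← lintegral_ofReal_mul_Ioi (fun r => ∫⁻ t in Set.Ico (0 : ℝ) (2 * Real.pi),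
      f (r * Complex.exp (Complex.I * t)))]
    refine lintegral_congr fun r => ?_
    rw [← lintegral_Ioo_neg_pi_pi_exp (fun w => f (r * w)), ← lintegral_const_mul' _ _ (by simp)]
    refine lintegral_congr fun t => ?_
    rw [Complex.polarCoord_symm_apply, mul_comm Complex.I, Complex.exp_mul_I]
    simp
  · refine Measurable.aemeasurable ?_
    have : Measurable fun p : ℝ × ℝ => Complex.polarCoord.symm p := by
      simp only [Complex.polarCoord_symm_apply]
      fun_prop
    simp only [smul_eq_mul]
    exact (by fun_prop : Measurable fun p : ℝ × ℝ => ENNReal.ofReal p.1).mul (hf.comp this)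

theorem pi_const_smul_measure {N : ℕ} (c : ENNReal) (hc : c ≠ ⊤) (μ : Measure ℝ) [SigmaFinite μ] :
    Measure.pi (fun _ : Fin N => c • μ) = c ^ N • Measure.pi (fun _ : Fin N => μ) := by
  lift c to NNReal using hc
  have : SigmaFinite ((c : ENNReal) • μ) := by
    change SigmaFinite (c • μ)
    infer_instance
  refine Measure.pi_eq fun s hs => ?_
  simp [Measure.pi_pi, Finset.prod_mul_distrib]

theorem lintegral_pi_complex_eq_sqrtPolar {N : ℕ} (g : (Fin N → ℂ) → ENNReal) (hg : Measurable g) :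
    ∫⁻ z, g z = (2⁻¹) ^ N * ∫⁻ u in Set.univ.pi fun _ : Fin N => Set.Ici (0 : ℝ),
      ∫⁻ t in Set.univ.pi fun _ : Fin N => Set.Ico (0 : ℝ) (2 * Real.pi),
        g (fun i => sqrtPolar (u i, t i)) := by
  have : SigmaFinite ((2⁻¹ : ENNReal) • (volume : Measure ℝ).restrict (Set.Ici (0 : ℝ))) := by
    have : (2⁻¹ : ENNReal) = ((2⁻¹ : NNReal) : ENNReal) := by simp
    rw [this]
    change SigmaFinite ((2⁻¹ : NNReal) • _)
    infer_instance
  have hm := continuous_sqrtPolar.measurable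
  have hmp : Measurable fun (x : Fin N → ℝ × ℝ) i => sqrtPolar (x i) := by fun_prop
  have e := (measurePreserving_arrowProdEquivProdArrow ℝ ℝ (Fin N)
    (fun _ => (2⁻¹ : ENNReal) • (volume : Measure ℝ).restrict (Set.Ici (0 : ℝ)))
    (fun _ => (volume : Measure ℝ).restrict (Set.Ico (0 : ℝ) (2 * Real.pi)))).symm
  have hG : Measurable fun p : (Fin N → ℝ) × (Fin N → ℝ) =>
      g (fun i => sqrtPolar (p.1 i, p.2 i)) := hg.comp (by fun_prop)
  have hmap : ∀ _ : Fin N, SigmaFinite (Measure.map sqrtPolar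
      (((2⁻¹ : ENNReal) • (volume : Measure ℝ).restrict (Set.Ici (0 : ℝ))).prod
        (volume.restrict (Set.Ico (0 : ℝ) (2 * Real.pi))))) := by
    rw [map_sqrtPolar]; infer_instance
  rw [volume_pi]
  conv_lhs => rw [← map_sqrtPolar]
  rw [← Measure.pi_map_pi (hμ := hmap) (fun _ => hm.aemeasurable), lintegral_map hg hmp, ← e.map_eq,
    lintegral_map (f := fun x : Fin N → ℝ × ℝ => g fun i => sqrtPolar (x i)) (hg.comp hmp)
      e.measurable]
  rw [pi_const_smul_measure _ (by simp), Measure.prod_smul_left, lintegral_smul_measure, smul_eq_mul]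
  congr 1
  rw [← Measure.restrict_pi_pi, ← Measure.restrict_pi_pi, ← volume_pi]
  exact lintegral_prod _ hG.aemeasurable

theorem lintegral_comp_pos_smul {m : ℕ} {r : ℝ} (hr : 0 < r) (k : (Fin m → ℝ) → ENNReal)
    (hk : Measurable k) :
    ∫⁻ v, k v = ENNReal.ofReal (r ^ m) * ∫⁻ v, k (r • v) := by
  have h := congrArg (fun μ => ∫⁻ v, k v ∂μ)
    (Measure.map_addHaar_smul (volume : Measure (Fin m → ℝ)) hr.ne')
  simp only [lintegral_map hk (measurable_const_smul r), lintegral_smul_measure, smul_eq_mul,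
    Module.finrank_fin_fun] at h
  rw [h, ← mul_assoc, ← ENNReal.ofReal_mul (by positivity), abs_of_pos (by positivity),
    mul_inv_cancel₀ (by positivity), ENNReal.ofReal_one, one_mul]

theorem measurable_snoc_sub_sum (m : ℕ) : Measurable fun p : ℝ × (Fin m → ℝ) =>
    (Fin.snoc (α := fun _ => ℝ) p.2 (p.1 - ∑ i, p.2 i) : Fin (m + 1) → ℝ) := by
  refine measurable_pi_lambda _ fun i => ?_
  refine Fin.lastCases ?_ (fun j => ?_) i
  · simp only [Fin.snoc_last]; fun_prop
  · simp only [Fin.snoc_castSucc]; fun_prop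

theorem lintegral_fin_succ_eq_sum {m : ℕ} (k : (Fin (m + 1) → ℝ) → ENNReal) (hk : Measurable k) :
    ∫⁻ u, k u = ∫⁻ r : ℝ, ∫⁻ v : Fin m → ℝ,
      k (Fin.snoc (α := fun _ => ℝ) v (r - ∑ i, v i)) := by
  have e := (volume_preserving_piFinSuccAbove (fun _ : Fin (m + 1) => ℝ) (Fin.last m)).symm
  have hsn := measurable_snoc_sub_sum m
  rw [← e.lintegral_comp hk, Measure.volume_eq_prod,
    lintegral_prod_symm (fun p => k ((MeasurableEquiv.piFinSuccAbove (fun _ => ℝ)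
      (Fin.last m)).symm p)) (hk.comp e.measurable).aemeasurable,
    lintegral_lintegral_swap (f := fun (r : ℝ) (v : Fin m → ℝ) =>
      k (Fin.snoc (α := fun _ => ℝ) v (r - ∑ i, v i))) (hk.comp hsn).aemeasurable]
  refine lintegral_congr fun v => ?_
  rw [lintegral_sub_right_eq_self (fun r => k (Fin.snoc (α := fun _ => ℝ) v r)) (∑ i, v i)]
  refine lintegral_congr fun r => ?_
  simp [MeasurableEquiv.piFinSuccAbove, Fin.insertNthEquiv, Fin.insertNth_last']

theorem measurableSet_simplex (m : ℕ) :
    MeasurableSet {s : Fin m → ℝ | (∀ i, s i ∈ Set.Icc (0 : ℝ) 1) ∧ ∑ i, s i ≤ 1} := by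
  have h1 : MeasurableSet {s : Fin m → ℝ | ∀ i, s i ∈ Set.Icc (0 : ℝ) 1} := by
    rw [Set.ofPred_forall]
    exact MeasurableSet.iInter fun i => measurable_pi_apply i measurableSet_Icc
  exact h1.inter (measurableSet_le (f := fun s : Fin m → ℝ => ∑ i, s i) (by fun_prop)
    measurable_const)

theorem lintegral_nonneg_eq_simplex {m : ℕ} (h : (Fin (m + 1) → ℝ) → ENNReal) (hh : Measurable h) :
    ∫⁻ u in Set.univ.pi fun _ : Fin (m + 1) => Set.Ici (0 : ℝ), h u
      = ∫⁻ x in Set.Ioi (0 : ℝ), ENNReal.ofReal (2 * x ^ (2 * m + 1)) *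
          ∫⁻ s in {s : Fin m → ℝ | (∀ i, s i ∈ Set.Icc (0 : ℝ) 1) ∧ ∑ i, s i ≤ 1},
            h (x ^ 2 • Fin.snoc (α := fun _ => ℝ) s (1 - ∑ i, s i)) := by
  set P : Set (Fin (m + 1) → ℝ) := Set.univ.pi fun _ => Set.Ici 0 with hP
  set S : Set (Fin m → ℝ) := {s | (∀ i, s i ∈ Set.Icc (0 : ℝ) 1) ∧ ∑ i, s i ≤ 1} with hS
  have hPm : MeasurableSet P := MeasurableSet.univ_pi fun _ => measurableSet_Ici
  have hSm : MeasurableSet S := measurableSet_simplex m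
  have hk : Measurable (P.indicator h) := hh.indicator hPm
  have hmem : ∀ (r : ℝ) (v : Fin m → ℝ), Fin.snoc (α := fun _ => ℝ) v (r - ∑ i, v i) ∈ P ↔
      (∀ i, 0 ≤ v i) ∧ ∑ i, v i ≤ r := fun r v => by
    rw [hP, Set.mem_univ_pi, Fin.forall_fin_succ']
    simp
  have hsmul : ∀ (r : ℝ) (v : Fin m → ℝ), (Fin.snoc (α := fun _ => ℝ) (r • v)
      (r - ∑ i, (r • v) i) : Fin (m + 1) → ℝ)
        = r • Fin.snoc (α := fun _ => ℝ) v (1 - ∑ i, v i) := fun r v => by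
    ext i
    refine Fin.lastCases ?_ (fun j => ?_) i
    · simp [← Finset.mul_sum, mul_sub]
    · simp
  have hsupp : (fun r : ℝ => ∫⁻ v : Fin m → ℝ, P.indicator h
      (Fin.snoc (α := fun _ => ℝ) v (r - ∑ i, v i))).support ⊆ Set.Ici 0 := by
    intro r hr
    by_contra hneg
    refine hr ?_
    refine (lintegral_congr fun v => ?_).trans lintegral_zero
    refine Set.indicator_of_notMem (fun hv => hneg ?_) _
    obtain ⟨h0, h1⟩ := (hmem r v).1 hv
    exact (Finset.sum_nonneg fun i _ => h0 i).trans h1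
  rw [← lintegral_indicator hPm, lintegral_fin_succ_eq_sum _ hk,
    ← setLIntegral_eq_of_support_subset hsupp, Measure.restrict_congr_set Ioi_ae_eq_Ici.symm,
    lintegral_Ioi_eq_lintegral_sq]
  refine setLIntegral_congr_fun measurableSet_Ioi fun x hx => ?_
  have hx' : (0 : ℝ) < x := hx
  have hx2 : 0 < x ^ 2 := pow_pos hx' 2
  have hsn := measurable_snoc_sub_sum m
  have hkx : Measurable fun v : Fin m → ℝ =>
      P.indicator h (Fin.snoc (α := fun _ => ℝ) v (x ^ 2 - ∑ i, v i)) :=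
    hk.comp (hsn.comp (measurable_prodMk_left (x := x ^ 2)))
  rw [lintegral_comp_pos_smul hx2 _ hkx,
    ← mul_assoc, ← ENNReal.ofReal_mul (by positivity), ← lintegral_indicator hSm]
  congr 2
  · ring
  · funext s
    have hmemS : x ^ 2 • (Fin.snoc (α := fun _ => ℝ) s (1 - ∑ i, s i) : Fin (m + 1) → ℝ) ∈ P ↔
        s ∈ S := by
      have h1 := hmem 1 s
      rw [hP, Set.mem_univ_pi] at h1 ⊢
      simp only [Pi.smul_apply, smul_eq_mul, Set.mem_Ici, mul_nonneg_iff_of_pos_left hx2] at h1 ⊢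
      rw [h1]
      refine ⟨fun ⟨h0, hs⟩ => ⟨fun i => ⟨h0 i, ?_⟩, hs⟩, fun ⟨h0, hs⟩ => ⟨fun i => (h0 i).1, hs⟩⟩
      exact (Finset.single_le_sum (fun j _ => h0 j) (Finset.mem_univ i)).trans hs
    simp only [hsmul]
    by_cases hs : s ∈ S
    · rw [Set.indicator_of_mem hs, Set.indicator_of_mem (hmemS.2 hs)]
    · rw [Set.indicator_of_notMem hs, Set.indicator_of_notMem (fun hc => hs (hmemS.1 hc))]

theorem psi1_succ_apply (m : ℕ) (p : (Fin m → ℝ) × (Fin (m + 1) → ℝ)) (i : Fin (m + 1)) :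
    psi1 (m + 1) p i
      = sqrtPolar (Fin.snoc (α := fun _ => ℝ) p.1 (1 - ∑ j, p.1 j) i, p.2 i) := by
  refine Fin.lastCases ?_ (fun j => ?_) i
  · simp [psi1, sqrtPolar]
  · simp [psi1, sqrtPolar]

/-- The parameter domain `Δ × [0,2π)^(m+1)`. -/
def simplexTorus (m : ℕ) : Set ((Fin m → ℝ) × (Fin (m + 1) → ℝ)) :=
  {p | (∀ i, p.1 i ∈ Set.Icc (0 : ℝ) 1) ∧ (∑ i, p.1 i) ≤ 1 ∧
    ∀ j, p.2 j ∈ Set.Ico (0 : ℝ) (2 * Real.pi)}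

theorem simplexTorus_eq_prod (m : ℕ) : simplexTorus m =
    {s : Fin m → ℝ | (∀ i, s i ∈ Set.Icc (0 : ℝ) 1) ∧ ∑ i, s i ≤ 1} ×ˢ
      Set.univ.pi fun _ : Fin (m + 1) => Set.Ico (0 : ℝ) (2 * Real.pi) := by
  ext p
  simp only [simplexTorus, Set.mem_ofPred_eq, Set.mem_prod, Set.mem_univ_pi, and_assoc]

theorem measurableSet_simplexTorus (m : ℕ) : MeasurableSet (simplexTorus m) := by
  rw [simplexTorus_eq_prod]
  exact (measurableSet_simplex m).prod (MeasurableSet.univ_pi fun _ => measurableSet_Ico)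

theorem measurable_smul_psi1 (m : ℕ) :
    Measurable fun q : ℝ × ((Fin m → ℝ) × (Fin (m + 1) → ℝ)) =>
      fun i => (q.1 : ℂ) * psi1 (m + 1) q.2 i := by
  refine measurable_pi_lambda _ fun i => ?_
  simp only [psi1_succ_apply]
  have h1 : Measurable fun q : ℝ × ((Fin m → ℝ) × (Fin (m + 1) → ℝ)) =>
      (Fin.snoc (α := fun _ => ℝ) q.2.1 (1 - ∑ j, q.2.1 j) : Fin (m + 1) → ℝ) i :=
    (measurable_pi_apply i).comp ((measurable_snoc_sub_sum m).comp
      (by fun_prop : Measurable fun q : ℝ × ((Fin m → ℝ) × (Fin (m + 1) → ℝ)) =>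
        ((1 : ℝ), q.2.1)))
  have h2 : Measurable fun q : ℝ × ((Fin m → ℝ) × (Fin (m + 1) → ℝ)) => (q.1 : ℂ) := by fun_prop
  exact h2.mul (continuous_sqrtPolar.measurable.comp (h1.prodMk (by fun_prop)))

theorem sqrtPolar_smul {x : ℝ} (hx : 0 ≤ x) (s t : ℝ) :
    sqrtPolar (x ^ 2 * s, t) = x * sqrtPolar (s, t) := by
  simp only [sqrtPolar, Real.sqrt_mul (sq_nonneg x), Real.sqrt_sq hx]
  push_cast
  ring

theorem normSq_sqrtPolar {s : ℝ} (hs : 0 ≤ s) (t : ℝ) : Complex.normSq (sqrtPolar (s, t)) = s := by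
  rw [Complex.normSq_eq_norm_sq, sqrtPolar, norm_mul, mul_comm Complex.I,
    Complex.norm_exp_ofReal_mul_I, mul_one, Complex.norm_real, Real.norm_of_nonneg (by positivity),
    Real.sq_sqrt hs]

/-- `psi1` takes values in the unit sphere. -/
theorem sum_normSq_psi1 {m : ℕ} {p : (Fin m → ℝ) × (Fin (m + 1) → ℝ)} (hp : p ∈ simplexTorus m) :
    ∑ i, Complex.normSq (psi1 (m + 1) p i) = 1 := by
  obtain ⟨h1, h2, -⟩ := hp
  simp only [psi1_succ_apply, Fin.sum_univ_castSucc, Fin.snoc_castSucc, Fin.snoc_last]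
  rw [normSq_sqrtPolar (sub_nonneg.2 h2), Finset.sum_congr rfl fun j _ =>
    normSq_sqrtPolar (h1 j).1 (p.2 j.castSucc)]
  ring

theorem lintegral_eq_lintegral_psi1 {m : ℕ} (g : (Fin (m + 1) → ℂ) → ENNReal) (hg : Measurable g) :
    ∫⁻ z, g z = (2⁻¹) ^ m * ∫⁻ x in Set.Ioi (0 : ℝ), ENNReal.ofReal (x ^ (2 * m + 1)) *
      ∫⁻ p in simplexTorus m, g (fun i => (x : ℂ) * psi1 (m + 1) p i) := by
  have hW : Measurable fun p : (Fin (m + 1) → ℝ) × (Fin (m + 1) → ℝ) =>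
      g (fun i => sqrtPolar (p.1 i, p.2 i)) := by
    have := continuous_sqrtPolar.measurable
    exact hg.comp (by fun_prop)
  rw [lintegral_pi_complex_eq_sqrtPolar g hg,
    lintegral_nonneg_eq_simplex _ hW.lintegral_prod_right', pow_succ, mul_assoc]
  congr 1
  rw [← lintegral_const_mul' _ _ (by simp)]
  refine setLIntegral_congr_fun measurableSet_Ioi fun x hx => ?_
  have hx' : (0 : ℝ) < x := hx
  rw [← mul_assoc, ENNReal.ofReal_mul two_pos.le, ← mul_assoc, ENNReal.ofReal_ofNat,
    ENNReal.inv_mul_cancel two_ne_zero ENNReal.ofNat_ne_top, one_mul, simplexTorus_eq_prod,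
    Measure.volume_eq_prod, ← Measure.prod_restrict, lintegral_prod]
  · simp only [psi1_succ_apply, Pi.smul_apply, smul_eq_mul, sqrtPolar_smul hx'.le]
  · exact (hg.comp ((measurable_smul_psi1 m).comp measurable_prodMk_left)).aemeasurable

theorem measurableSet_normSq_ball (N : ℕ) :
    MeasurableSet {z : Fin N → ℂ | ∑ i, Complex.normSq (z i) ≤ 1} := by
  have := Complex.continuous_normSq
  exact (isClosed_le (by fun_prop) continuous_const).measurableSet

theorem isCompact_normSq_ball (N : ℕ) :
    IsCompact {z : Fin N → ℂ | ∑ i, Complex.normSq (z i) ≤ 1} := by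
  have := Complex.continuous_normSq
  refine Metric.isCompact_of_isClosed_isBounded (isClosed_le (by fun_prop) continuous_const)
    (Metric.isBounded_closedBall (x := (0 : Fin N → ℂ)) (r := 1) |>.subset fun z hz => ?_)
  rw [mem_closedBall_zero_iff, pi_norm_le_iff_of_nonneg zero_le_one]
  intro i
  have h1 : Complex.normSq (z i) ≤ 1 :=
    (Finset.single_le_sum (fun j _ => Complex.normSq_nonneg (z j)) (Finset.mem_univ i)).trans hz
  rw [Complex.normSq_eq_norm_sq] at h1
  exact (sq_le_one_iff₀ (norm_nonneg _)).1 h1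

/-- Polar decomposition of Lebesgue measure on the unit ball, as an image measure. -/
theorem restrict_ball_eq_map_psi1 (m : ℕ) :
    volume.restrict {z : Fin (m + 1) → ℂ | ∑ i, Complex.normSq (z i) ≤ 1}
      = (2⁻¹ : ENNReal) ^ m • Measure.map (fun q : ℝ × ((Fin m → ℝ) × (Fin (m + 1) → ℝ)) =>
          fun i => (q.1 : ℂ) * psi1 (m + 1) q.2 i)
        (((volume.restrict (Set.Icc (0 : ℝ) 1)).withDensity
          fun x => ENNReal.ofReal (x ^ (2 * m + 1))).prod (volume.restrict (simplexTorus m))) := by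
  refine Measure.ext_of_lintegral _ fun g hg => ?_
  have hΦ := measurable_smul_psi1 m
  have hB := measurableSet_normSq_ball (m + 1)
  have hgΦ : Measurable fun x : ℝ => ∫⁻ p in simplexTorus m,
      g fun i => (x : ℂ) * psi1 (m + 1) p i := (hg.comp hΦ).lintegral_prod_right'
  rw [lintegral_smul_measure, lintegral_map hg hΦ, ← lintegral_indicator hB,
    lintegral_eq_lintegral_psi1 _ (hg.indicator hB), smul_eq_mul,
    lintegral_prod (fun q : ℝ × ((Fin m → ℝ) × (Fin (m + 1) → ℝ)) =>
      g fun i => (q.1 : ℂ) * psi1 (m + 1) q.2 i) (hg.comp hΦ).aemeasurable,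
    lintegral_withDensity_eq_lintegral_mul _ (by fun_prop) hgΦ,
    Measure.restrict_congr_set Ioc_ae_eq_Icc.symm, ← lintegral_indicator measurableSet_Ioi,
    ← lintegral_indicator measurableSet_Ioc]
  congr 1
  refine lintegral_congr fun x => ?_
  by_cases hx0 : 0 < x
  swap
  · rw [Set.indicator_of_notMem (s := Set.Ioi 0) hx0,
      Set.indicator_of_notMem (s := Set.Ioc 0 1) fun h => hx0 h.1]
  rw [Set.indicator_of_mem (Set.mem_Ioi.2 hx0)]
  have hmem : ∀ p ∈ simplexTorus m, ((fun i => (x : ℂ) * psi1 (m + 1) p i) ∈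
      {z : Fin (m + 1) → ℂ | ∑ i, Complex.normSq (z i) ≤ 1} ↔ x ≤ 1) := fun p hp => by
    simp only [Set.mem_ofPred_eq, Complex.normSq_mul, Complex.normSq_ofReal, ← Finset.mul_sum,
      sum_normSq_psi1 hp, mul_one]
    rw [← sq, sq_le_one_iff₀ hx0.le]
  by_cases hx1 : x ≤ 1
  · rw [Set.indicator_of_mem (s := Set.Ioc 0 1) ⟨hx0, hx1⟩, Pi.mul_apply]
    congr 1
    exact setLIntegral_congr_fun (measurableSet_simplexTorus m) fun p hp =>
      Set.indicator_of_mem ((hmem p hp).2 hx1) _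
  · rw [Set.indicator_of_notMem (s := Set.Ioc 0 1) fun h => hx1 h.2, setLIntegral_congr_fun
      (measurableSet_simplexTorus m) fun p hp =>
        Set.indicator_of_notMem (fun hc => hx1 ((hmem p hp).1 hc)) _]
    simp

theorem stmt17 (n : ℕ) (hn : 1 ≤ n) (f : (Fin n → ℂ) → ℝ)
    (hf : ContinuousOn f {z : Fin n → ℂ | ∑ i, Complex.normSq (z i) ≤ 1}) :
    (∫ z in {z : Fin n → ℂ | ∑ i, Complex.normSq (z i) ≤ 1}, f z)
      = (1 / 2 ^ (n - 1)) *
          ∫ ρ in Set.Icc (0 : ℝ) 1,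
            ρ ^ (2 * n - 1) *
              ∫ p in {p : (Fin (n - 1) → ℝ) × (Fin n → ℝ) |
                  (∀ i, p.1 i ∈ Set.Icc (0 : ℝ) 1) ∧ (∑ i, p.1 i) ≤ 1 ∧
                    ∀ j, p.2 j ∈ Set.Ico (0 : ℝ) (2 * Real.pi)},
                f (fun i => ((ρ : ℝ) : ℂ) * psi1 n p i) := by
  obtain ⟨m, rfl⟩ : ∃ m, n = m + 1 := ⟨n - 1, by omega⟩
  have hint : IntegrableOn f {z : Fin (m + 1) → ℂ | ∑ i, Complex.normSq (z i) ≤ 1} :=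
    hf.integrableOn_compact (isCompact_normSq_ball (m + 1))
  have hΦ := measurable_smul_psi1 m
  rw [IntegrableOn, restrict_ball_eq_map_psi1,
    integrable_smul_measure (by simp) (by simp)] at hint
  have hint' := (integrable_map_measure hint.aestronglyMeasurable hΦ.aemeasurable).1 hint
  rw [restrict_ball_eq_map_psi1, integral_smul_measure,
    integral_map hΦ.aemeasurable hint.aestronglyMeasurable,
    integral_prod (fun q : ℝ × ((Fin m → ℝ) × (Fin (m + 1) → ℝ)) =>
      f fun i => (q.1 : ℂ) * psi1 (m + 1) q.2 i) hint',
    integral_withDensity_eq_integral_toReal_smul (by fun_prop) (by simp)]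
  have hpow : 2 * (m + 1) - 1 = 2 * m + 1 := by omega
  rw [hpow, smul_eq_mul]
  congr 1
  · simp
  · refine setIntegral_congr_fun measurableSet_Icc fun x hx => ?_
    simp only [ENNReal.toReal_ofReal (pow_nonneg hx.1 _), smul_eq_mul]
    rfl
end
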